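/- arXiv:1204.4284 — 16 statements merged into one kernel-verified Lean document; each statement's English description precedes it below -/
import Mathlib

section
/- Let H be a real Hilbert space and let U_i : H → H, i = 1,…,m, be cutter operators with ⋂_{i=1}^m Fix U_i ≠ ∅. Set U := U_m U_{m−1} ⋯ U_1, S_0 := I, S_i := U_i U_{i−1} ⋯ U_1, and for x ∈ H let y^i := S_i x − S_{i−1} x, i = 1,…,m. Then for any z ∈ ⋂_{i=1}^m Fix U_i and any x ∈ H, ⟨Ux − x, z − x⟩ ≥ Σ_{i=1}^m ⟨y^i + y^{i+1} + ⋯ + y^m, y^i⟩. -/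
local notation "⟪" x ", " y "⟫" => @inner ℝ _ _ x y

theorem aux_ineq {H : Type*} [NormedAddCommGroup H] [InnerProductSpace ℝ H]
    (s : ℕ → H) (z : H) (n : ℕ)
    (h : ∀ i < n, ⟪s (i + 1) - s i, z - s i⟫ ≥ ‖s (i + 1) - s i‖ ^ 2) :
    ⟪s n - s 0, z - s 0⟫ ≥ ∑ i ∈ Finset.range n, ⟪s n - s i, s (i + 1) - s i⟫ := by
  induction n with
  | zero => simp
  | succ n ih =>
    have h1 := ih (fun i hi => h i (by omega))
    have h2 := h n (by omega)
    have h3 : ∑ i ∈ Finset.range n, ⟪s (n + 1) - s i, s (i + 1) - s i⟫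
        = ⟪s (n + 1) - s n, s n - s 0⟫
          + ∑ i ∈ Finset.range n, ⟪s n - s i, s (i + 1) - s i⟫ := by
      rw [← Finset.sum_range_sub s n, inner_sum, ← Finset.sum_add_distrib]
      refine Finset.sum_congr rfl fun i _ => ?_
      rw [← inner_add_left, sub_add_sub_cancel]
    rw [Finset.sum_range_succ, h3, real_inner_self_eq_norm_sq]
    have h4 : ⟪s (n + 1) - s 0, z - s 0⟫ = ⟪s (n + 1) - s n, z - s n⟫
        + ⟪s (n + 1) - s n, s n - s 0⟫ + ⟪s n - s 0, z - s 0⟫ := by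
      rw [← inner_add_right, sub_add_sub_cancel, ← inner_add_left, sub_add_sub_cancel]
    linarith

theorem aux_sum {H : Type*} [AddCommGroup H] (s : ℕ → H) (m i : ℕ) (hi : i ≤ m) :
    ∑ j ∈ Finset.Icc (i + 1) m, (s j - s (j - 1)) = s m - s i := by
  induction m, hi using Nat.le_induction with
  | base => simp
  | succ m hm ih => rw [Finset.sum_Icc_succ_top (by omega), ih]; simp

/-- Let `U_1, …, U_m` be cutter operators on a real Hilbert space `H` with
`⋂_{i=1}^m Fix U_i ≠ ∅`.  With `U := U_m ⋯ U_1`, `S_0 := I`, `S_i := U_i ⋯ U_1` and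
`y^i := S_i x − S_{i−1} x`, for any `z ∈ ⋂_{i=1}^m Fix U_i` and any `x ∈ H`,
`⟪Ux − x, z − x⟫ ≥ Σ_{i=1}^m ⟪y^i + ⋯ + y^m, y^i⟫`. -/
theorem inner_comp_cutters_ge_sum
    {H : Type*} [NormedAddCommGroup H] [InnerProductSpace ℝ H]
    (m : ℕ) (hm : 1 ≤ m) (U : ℕ → H → H)
    (hcut : ∀ i ∈ Finset.Icc 1 m, ∀ z x : H, U i z = z →
      ⟪U i x - x, z - x⟫ ≥ ‖U i x - x‖ ^ 2)
    (hne : ∃ z : H, ∀ i ∈ Finset.Icc 1 m, U i z = z)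
    (S : ℕ → H → H) (hS0 : ∀ x : H, S 0 x = x)
    (hS : ∀ i, ∀ x : H, S (i + 1) x = U (i + 1) (S i x))
    (z : H) (hz : ∀ i ∈ Finset.Icc 1 m, U i z = z) (x : H) :
    ⟪S m x - x, z - x⟫ ≥
      ∑ i ∈ Finset.Icc 1 m,
        ⟪∑ j ∈ Finset.Icc i m, (S j x - S (j - 1) x), S i x - S (i - 1) x⟫ := by
  have key := aux_ineq (fun i => S i x) z m (fun i hi => by
    have := hcut (i + 1) (by simp; omega) z (S i x) (hz _ (by simp; omega))
    simpa only [hS] using this)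
  simp only [hS0] at key
  have e : ∑ i ∈ Finset.Icc 1 m,
        ⟪∑ j ∈ Finset.Icc i m, (S j x - S (j - 1) x), S i x - S (i - 1) x⟫
      = ∑ i ∈ Finset.range m, ⟪S m x - S i x, S (i + 1) x - S i x⟫ := by
    have hI : Finset.Icc 1 m = Finset.Ico (0 + 1) (m + 1) := by ext; simp <;> omega
    rw [hI, ← Finset.sum_Ico_add', ← Finset.range_eq_Ico]
    refine Finset.sum_congr rfl fun i hi => ?_
    rw [aux_sum (fun j => S j x) m i (Finset.mem_range.1 hi).le, Nat.add_sub_cancel]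
  rw [e]
  exact key
end

section
/- Let H be a real Hilbert space and let U_i : H → H, i = 1,…,m, be cutter operators with ⋂_{i=1}^m Fix U_i ≠ ∅. Set U := U_m U_{m−1} ⋯ U_1, S_0 := I, S_i := U_i U_{i−1} ⋯ U_1. Then for any z ∈ ⋂_{i=1}^m Fix U_i and any x ∈ H, ⟨Ux − x, z − x⟩ ≥ (1/2) Σ_{i=1}^m ‖S_i x − S_{i−1} x‖² ≥ (1/(2m)) ‖Ux − x‖². -/
local notation "⟪" x ", " y "⟫" => @inner ℝ _ _ x y

/-- Let `U_1, …, U_m` be cutter operators on a real Hilbert space `H` with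
`⋂_{i=1}^m Fix U_i ≠ ∅`.  With `U := U_m ⋯ U_1`, `S_0 := I`, `S_i := U_i ⋯ U_1`,
for any `z ∈ ⋂_{i=1}^m Fix U_i` and any `x ∈ H`,
`⟪Ux − x, z − x⟫ ≥ (1/2) Σ_{i=1}^m ‖S_i x − S_{i−1} x‖² ≥ (1/(2m)) ‖Ux − x‖²`. -/
theorem inner_comp_cutters_ge_half_sum_sq
    {H : Type*} [NormedAddCommGroup H] [InnerProductSpace ℝ H]
    (m : ℕ) (hm : 1 ≤ m) (U : ℕ → H → H)
    (hcut : ∀ i ∈ Finset.Icc 1 m, ∀ z x : H, U i z = z →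
      ⟪U i x - x, z - x⟫ ≥ ‖U i x - x‖ ^ 2)
    (hne : ∃ z : H, ∀ i ∈ Finset.Icc 1 m, U i z = z)
    (S : ℕ → H → H) (hS0 : ∀ x : H, S 0 x = x)
    (hS : ∀ i, ∀ x : H, S (i + 1) x = U (i + 1) (S i x))
    (z : H) (hz : ∀ i ∈ Finset.Icc 1 m, U i z = z) (x : H) :
    ⟪S m x - x, z - x⟫ ≥ (1 / 2) * ∑ i ∈ Finset.Icc 1 m, ‖S i x - S (i - 1) x‖ ^ 2 ∧
      (1 / 2) * (∑ i ∈ Finset.Icc 1 m, ‖S i x - S (i - 1) x‖ ^ 2) ≥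
        (1 / (2 * (m : ℝ))) * ‖S m x - x‖ ^ 2 := by
  have key : ∀ k, k ≤ m → ⟪S k x - x, z - x⟫ ≥
      (1 / 2) * ∑ i ∈ Finset.Icc 1 k, ‖S i x - S (i - 1) x‖ ^ 2 + (1 / 2) * ‖S k x - x‖ ^ 2 := by
    intro k
    induction k with
    | zero => intro _; simp [hS0]
    | succ k ih =>
      intro hk
      have h1 := ih (by omega)
      have hmem : k + 1 ∈ Finset.Icc 1 m := Finset.mem_Icc.mpr ⟨by omega, hk⟩
      have h2 := hcut (k + 1) hmem z (S k x) (hz _ hmem)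
      rw [← hS] at h2
      rw [Finset.sum_Icc_succ_top (by omega), Nat.add_sub_cancel]
      obtain ⟨d, hd⟩ : ∃ d, d = S (k + 1) x - S k x := ⟨_, rfl⟩
      obtain ⟨a, ha⟩ : ∃ a, a = S k x - x := ⟨_, rfl⟩
      have e1 : S (k + 1) x - x = a + d := by rw [hd, ha]; abel
      have e2 : z - S k x = (z - x) - a := by rw [ha]; abel
      rw [e2, ← hd, inner_sub_right] at h2
      rw [← ha] at h1
      rw [e1, ← hd, inner_add_left, norm_add_sq_real]
      have := real_inner_comm a d
      linarith
  have tel : ∀ k, ‖S k x - x‖ ≤ ∑ i ∈ Finset.Icc 1 k, ‖S i x - S (i - 1) x‖ := by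
    intro k
    induction k with
    | zero => simp [hS0]
    | succ k ih =>
      rw [Finset.sum_Icc_succ_top (by omega), Nat.add_sub_cancel]
      have := norm_add_le (S k x - x) (S (k + 1) x - S k x)
      rw [show S k x - x + (S (k + 1) x - S k x) = S (k + 1) x - x by abel] at this
      linarith
  constructor
  · have := key m le_rfl
    have := sq_nonneg ‖S m x - x‖
    linarith
  · have h1 := pow_le_pow_left₀ (norm_nonneg _) (tel m) 2
    have h2 := sq_sum_le_card_mul_sum_sq (s := Finset.Icc 1 m)
      (f := fun i => ‖S i x - S (i - 1) x‖)
    rw [Nat.card_Icc, Nat.add_sub_cancel] at h2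
    have hm' : (0 : ℝ) < m := by exact_mod_cast hm
    have h3 := h1.trans h2
    rw [ge_iff_le, one_div_mul_eq_div, div_le_iff₀ (by positivity)]
    linarith
end

section
/- Let H be a real Hilbert space and let U_i : H → H, i = 1,…,m, be cutter operators with ⋂_{i=1}^m Fix U_i ≠ ∅, and set U := U_m ⋯ U_1, S_0 := I, S_i := U_i ⋯ U_1. Then for every x ∉ Fix U, the step size σ_max(x) := (Σ_{i=1}^m ⟨Ux − S_{i−1}x, S_i x − S_{i−1}x⟩)/‖Ux − x‖² satisfies σ_max(x) ≥ (1/2) (Σ_{i=1}^m ‖S_i x − S_{i−1} x‖²)/‖Ux − x‖² ≥ 1/(2m). -/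
local notation "⟪" x ", " y "⟫" => @inner ℝ _ _ x y

theorem aux_sum_identity {H : Type*} [NormedAddCommGroup H] [InnerProductSpace ℝ H]
    (a : ℕ → H) (p : H) (n : ℕ) :
    ∑ i ∈ Finset.Icc 1 n, inner ℝ (p - a (i - 1)) (a i - a (i - 1)) =
      (1 / 2) * (‖p - a 0‖ ^ 2 - ‖p - a n‖ ^ 2 +
        ∑ i ∈ Finset.Icc 1 n, ‖a i - a (i - 1)‖ ^ 2) := by
  induction n with
  | zero => simp
  | succ k ih =>
    rw [Finset.sum_Icc_succ_top (by omega), Finset.sum_Icc_succ_top (by omega), ih]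
    simp only [Nat.add_sub_cancel]
    have h := norm_sub_sq_real (p - a k) (a (k + 1) - a k)
    rw [sub_sub_sub_cancel_right] at h
    linarith

theorem aux_norm_le {H : Type*} [NormedAddCommGroup H]
    (a : ℕ → H) (n : ℕ) :
    ‖a n - a 0‖ ≤ ∑ i ∈ Finset.Icc 1 n, ‖a i - a (i - 1)‖ := by
  induction n with
  | zero => simp
  | succ k ih =>
    rw [Finset.sum_Icc_succ_top (by omega)]
    simp only [Nat.add_sub_cancel]
    have h := norm_sub_le_norm_sub_add_norm_sub (a (k + 1)) (a k) (a 0)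
    linarith

/-- Let `U_1, …, U_m` be cutter operators on a real Hilbert space `H` with
`⋂_{i=1}^m Fix U_i ≠ ∅`, `U := U_m ⋯ U_1`, `S_0 := I`, `S_i := U_i ⋯ U_1`.  For every
`x ∉ Fix U`, the step size
`σ_max(x) := (Σ_{i=1}^m ⟪Ux − S_{i−1}x, S_i x − S_{i−1}x⟫)/‖Ux − x‖²` satisfies
`σ_max(x) ≥ (1/2)(Σ_{i=1}^m ‖S_i x − S_{i−1}x‖²)/‖Ux − x‖² ≥ 1/(2m)`. -/
theorem sigma_max_ge_half_ratio_ge_inv_two_m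
    {H : Type*} [NormedAddCommGroup H] [InnerProductSpace ℝ H]
    (m : ℕ) (hm : 1 ≤ m) (U : ℕ → H → H)
    (hcut : ∀ i ∈ Finset.Icc 1 m, ∀ z x : H, U i z = z →
      ⟪U i x - x, z - x⟫ ≥ ‖U i x - x‖ ^ 2)
    (hne : ∃ z : H, ∀ i ∈ Finset.Icc 1 m, U i z = z)
    (S : ℕ → H → H) (hS0 : ∀ x : H, S 0 x = x)
    (hS : ∀ i, ∀ x : H, S (i + 1) x = U (i + 1) (S i x))
    (x : H) (hx : S m x ≠ x) :
    (∑ i ∈ Finset.Icc 1 m, ⟪S m x - S (i - 1) x, S i x - S (i - 1) x⟫) / ‖S m x - x‖ ^ 2 ≥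
        (1 / 2) * (∑ i ∈ Finset.Icc 1 m, ‖S i x - S (i - 1) x‖ ^ 2) / ‖S m x - x‖ ^ 2 ∧
      (1 / 2) * (∑ i ∈ Finset.Icc 1 m, ‖S i x - S (i - 1) x‖ ^ 2) / ‖S m x - x‖ ^ 2 ≥
        1 / (2 * (m : ℝ)) := by
  have hpos : 0 < ‖S m x - x‖ ^ 2 := by
    have := norm_pos_iff.mpr (sub_ne_zero.mpr hx)
    positivity
  have hm' : (0 : ℝ) < m := by exact_mod_cast hm
  have h1 := aux_sum_identity (fun i => S i x) (S m x) m
  have h2 := aux_norm_le (fun i => S i x) m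
  simp only [hS0, sub_self, norm_zero] at h1 h2
  have h3 := sq_sum_le_card_mul_sum_sq (s := Finset.Icc 1 m)
    (f := fun i => ‖S i x - S (i - 1) x‖)
  simp only [Nat.card_Icc, Nat.add_sub_cancel] at h3
  have h4 := pow_le_pow_left₀ (norm_nonneg _) h2 2
  constructor
  · apply div_le_div_of_nonneg_right _ hpos.le
    rw [h1]
    linarith
  · rw [ge_iff_le, div_le_div_iff₀ (by positivity) hpos]
    linarith
end

section
/- Let H be a real Hilbert space, let U_i : H → H, i = 1,…,m, be cutter operators with ⋂_{i=1}^m Fix U_i ≠ ∅, and set U := U_m ⋯ U_1, S_0 := I, S_i := U_i ⋯ U_1. Define σ_max : H → (0,∞) by σ_max(x) := (Σ_{i=1}^m ⟨Ux − S_{i−1}x, S_i x − S_{i−1}x⟩)/‖Ux − x‖² for x ∉ Fix U and σ_max(x) := 1 for x ∈ Fix U, and define U_σ : H → H by U_σ x := x + σ_max(x)(Ux − x). Then U_σ is a cutter; in particular, for every z ∈ ⋂_{i=1}^m Fix U_i and every x ∈ H, ⟨U_σ x − x, z − x⟩ ≥ ‖U_σ x − x‖². -/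
local notation "⟪" x ", " y "⟫" => @inner ℝ _ _ x y

/-- Let `U_1, …, U_m` be cutter operators on a real Hilbert space `H` with
`⋂_{i=1}^m Fix U_i ≠ ∅`, `U := U_m ⋯ U_1`, `S_0 := I`, `S_i := U_i ⋯ U_1`.  With
`σ_max(x) := (Σ_{i=1}^m ⟪Ux − S_{i−1}x, S_i x − S_{i−1}x⟫)/‖Ux − x‖²` for `x ∉ Fix U`
and `σ_max(x) := 1` for `x ∈ Fix U`, the operator `U_σ x := x + σ_max(x)(Ux − x)` is a
cutter: for every `z ∈ ⋂_{i=1}^m Fix U_i` and every `x ∈ H`,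
`⟪U_σ x − x, z − x⟫ ≥ ‖U_σ x − x‖²` (note `Fix U_σ = Fix U = ⋂_{i=1}^m Fix U_i`). -/
theorem extrapolated_cyclic_cutter_is_cutter
    {H : Type*} [NormedAddCommGroup H] [InnerProductSpace ℝ H]
    (m : ℕ) (hm : 1 ≤ m) (U : ℕ → H → H)
    (hcut : ∀ i ∈ Finset.Icc 1 m, ∀ z x : H, U i z = z →
      ⟪U i x - x, z - x⟫ ≥ ‖U i x - x‖ ^ 2)
    (hne : ∃ z : H, ∀ i ∈ Finset.Icc 1 m, U i z = z)
    (S : ℕ → H → H) (hS0 : ∀ x : H, S 0 x = x)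
    (hS : ∀ i, ∀ x : H, S (i + 1) x = U (i + 1) (S i x))
    (σ : H → ℝ)
    (hσ : ∀ x : H, S m x ≠ x → σ x =
      (∑ i ∈ Finset.Icc 1 m, ⟪S m x - S (i - 1) x, S i x - S (i - 1) x⟫) / ‖S m x - x‖ ^ 2)
    (hσfix : ∀ x : H, S m x = x → σ x = 1)
    (Uσ : H → H) (hUσ : ∀ x : H, Uσ x = x + σ x • (S m x - x)) :
    ∀ z : H, (∀ i ∈ Finset.Icc 1 m, U i z = z) →
      ∀ x : H, ⟪Uσ x - x, z - x⟫ ≥ ‖Uσ x - x‖ ^ 2 := by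
  intro z hz x
  set D : ℕ → ℝ := fun k => ∑ i ∈ Finset.Icc 1 k, ‖S i x - S (i - 1) x‖ ^ 2 with hD
  have hDs : ∀ k, D (k + 1) = D k + ‖S (k + 1) x - S k x‖ ^ 2 := by
    intro k
    simp only [hD]
    rw [Finset.sum_Icc_succ_top (by omega)]
    simp
  have hD0 : D 0 = 0 := by simp [hD]
  have hDnn : ∀ k, 0 ≤ D k := fun k => Finset.sum_nonneg fun i _ => by positivity
  have h1 : ∀ (w : H) (k : ℕ),
      ∑ i ∈ Finset.Icc 1 k, ⟪w - S (i - 1) x, S i x - S (i - 1) x⟫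
        = ⟪w - x, S k x - x⟫ - (‖S k x - x‖ ^ 2 - D k) / 2 := by
    intro w k
    induction k with
    | zero => simp [hD0, hS0]
    | succ k ih =>
      rw [Finset.sum_Icc_succ_top (by omega), ih, hDs]
      simp only [Nat.add_sub_cancel, ← real_inner_self_eq_norm_sq, inner_sub_left,
        inner_sub_right]
      rw [real_inner_comm (S k x) x, real_inner_comm (S (k + 1) x) x,
        real_inner_comm (S (k + 1) x) (S k x)]
      ring
  have h2 : ∀ k, k ≤ m → ⟪S k x - x, z - x⟫ ≥ (‖S k x - x‖ ^ 2 + D k) / 2 := by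
    intro k
    induction k with
    | zero => intro _; simp [hD0, hS0]
    | succ k ih =>
      intro hk
      have ih := ih (by omega)
      have hmem : k + 1 ∈ Finset.Icc 1 m := by simp; omega
      have hc := hcut (k + 1) hmem z (S k x) (hz _ hmem)
      rw [← hS] at hc
      rw [hDs]
      simp only [← real_inner_self_eq_norm_sq, inner_sub_left, inner_sub_right] at *
      rw [real_inner_comm (S k x) x] at *
      rw [real_inner_comm (S (k + 1) x) x] at *
      rw [real_inner_comm (S (k + 1) x) (S k x)] at *
      linarith
  have hU : Uσ x - x = σ x • (S m x - x) := by rw [hUσ]; abel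
  rw [hU]
  have h2m := h2 m le_rfl
  by_cases hx : S m x = x
  · simp [hx]
  · have hpos : 0 < ‖S m x - x‖ ^ 2 := by
      have := norm_pos_iff.mpr (sub_ne_zero.mpr hx)
      positivity
    have hs : σ x * ‖S m x - x‖ ^ 2 = (‖S m x - x‖ ^ 2 + D m) / 2 := by
      rw [hσ x hx, div_mul_cancel₀ _ hpos.ne', h1, real_inner_self_eq_norm_sq]
      ring
    have hs0 : 0 ≤ σ x := by
      have := hDnn m
      by_contra hneg
      push Not at hneg
      nlinarith [mul_neg_of_neg_of_pos hneg hpos]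
    rw [norm_smul, mul_pow, Real.norm_eq_abs, sq_abs, real_inner_smul_left, sq (σ x), mul_assoc,
      hs]
    exact mul_le_mul_of_nonneg_left h2m hs0
end

section
/- Let H be a real Hilbert space, let U_i : H → H, i = 1,…,m, be cutter operators with ⋂_{i=1}^m Fix U_i ≠ ∅, set U := U_m ⋯ U_1, S_0 := I, S_i := U_i ⋯ U_1, and let σ_max(x) := (Σ_{i=1}^m ⟨Ux − S_{i−1}x, S_i x − S_{i−1}x⟩)/‖Ux − x‖² for x ∉ Fix U, σ_max(x) := 1 otherwise. Let ε ∈ (0,1), let λ_k ∈ [ε, 2−ε] for all k, and define x^{k+1} := x^k + λ_k σ_max(x^k)(Ux^k − x^k). Then for every k with x^k ∉ Fix U and every z ∈ Fix U, ‖x^{k+1} − z‖² ≤ ‖x^k − z‖² − (λ_k(2−λ_k)/4) · (Σ_{i=1}^m ‖S_i x^k − S_{i−1} x^k‖²)²/‖Ux^k − x^k‖² ≤ ‖x^k − z‖² − (λ_k(2−λ_k)/(4m²)) ‖Ux^k − x^k‖². -/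
local notation "⟪" x ", " y "⟫" => @inner ℝ _ _ x y

theorem fejer_aux_sum {H : Type*} [NormedAddCommGroup H] [InnerProductSpace ℝ H]
    (a : ℕ → H) (c : H) (n : ℕ) :
    2 * (∑ i ∈ Finset.Icc 1 n, ⟪c - a (i - 1), a i - a (i - 1)⟫) =
      ‖c - a 0‖ ^ 2 - ‖c - a n‖ ^ 2 + ∑ i ∈ Finset.Icc 1 n, ‖a i - a (i - 1)‖ ^ 2 := by
  induction n with
  | zero => simp
  | succ n ih =>
    rw [Finset.sum_Icc_succ_top (by omega), Finset.sum_Icc_succ_top (by omega), mul_add, ih]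
    simp only [Nat.add_sub_cancel]
    have h : c - a (n + 1) = (c - a n) - (a (n + 1) - a n) := by abel
    rw [h, norm_sub_sq_real (c - a n)]
    ring

theorem fejer_aux_norm {H : Type*} [NormedAddCommGroup H] [InnerProductSpace ℝ H]
    (a : ℕ → H) (n : ℕ) :
    ‖a n - a 0‖ ^ 2 ≤ n * ∑ i ∈ Finset.Icc 1 n, ‖a i - a (i - 1)‖ ^ 2 := by
  have h1 : a n - a 0 = ∑ i ∈ Finset.Icc 1 n, (a i - a (i - 1)) := by
    induction n with
    | zero => simp
    | succ n ih =>
      rw [Finset.sum_Icc_succ_top (by omega), ← ih]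
      simp
  have h2 := norm_sum_le (Finset.Icc 1 n) (fun i => a i - a (i - 1))
  have h3 := sq_sum_le_card_mul_sum_sq (s := Finset.Icc 1 n) (f := fun i => ‖a i - a (i - 1)‖)
  rw [← h1] at h2
  simp only [Nat.card_Icc, Nat.add_sub_cancel] at h3
  exact (pow_le_pow_left₀ (norm_nonneg _) h2 2).trans h3

theorem fejer_aux_quasi {H : Type*} [NormedAddCommGroup H] [InnerProductSpace ℝ H]
    (m : ℕ) (U : ℕ → H → H)
    (hcut : ∀ i ∈ Finset.Icc 1 m, ∀ z x : H, U i z = z →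
      ⟪U i x - x, z - x⟫ ≥ ‖U i x - x‖ ^ 2)
    (S : ℕ → H → H) (hS0 : ∀ x : H, S 0 x = x)
    (hS : ∀ i, ∀ x : H, S (i + 1) x = U (i + 1) (S i x))
    (z : H) (hz : ∀ i ∈ Finset.Icc 1 m, U i z = z) (x : H) :
    ∑ i ∈ Finset.Icc 1 m, ‖S i x - S (i - 1) x‖ ^ 2 ≤ ‖z - x‖ ^ 2 - ‖z - S m x‖ ^ 2 := by
  have h := fejer_aux_sum (fun i => S i x) z m
  simp only [hS0] at h
  have h2 : ∑ i ∈ Finset.Icc 1 m, ‖S i x - S (i - 1) x‖ ^ 2 ≤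
      ∑ i ∈ Finset.Icc 1 m, ⟪z - S (i - 1) x, S i x - S (i - 1) x⟫ := by
    apply Finset.sum_le_sum
    intro i hi
    obtain ⟨j, rfl⟩ : ∃ j, i = j + 1 := ⟨i - 1, by have := (Finset.mem_Icc.1 hi).1; omega⟩
    have := hcut _ hi z (S j x) (hz _ hi)
    rw [← hS, real_inner_comm] at this
    simpa using this
  linarith

/-- Let `U_1, …, U_m` be cutter operators on a real Hilbert space `H` with
`⋂_{i=1}^m Fix U_i ≠ ∅`, `U := U_m ⋯ U_1`, `S_0 := I`, `S_i := U_i ⋯ U_1`, and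
`σ_max(x) := (Σ_{i=1}^m ⟪Ux − S_{i−1}x, S_i x − S_{i−1}x⟫)/‖Ux − x‖²` for `x ∉ Fix U`,
`σ_max(x) := 1` otherwise.  Let `ε ∈ (0,1)`, `λ_k ∈ [ε, 2−ε]`, and
`x^{k+1} := x^k + λ_k σ_max(x^k)(Ux^k − x^k)`.  Then for every `k` with `x^k ∉ Fix U` and
every `z ∈ Fix U`,
`‖x^{k+1} − z‖² ≤ ‖x^k − z‖² − (λ_k(2−λ_k)/4)(Σ_{i=1}^m ‖S_i x^k − S_{i−1}x^k‖²)²/‖Ux^k − x^k‖²`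
`≤ ‖x^k − z‖² − (λ_k(2−λ_k)/(4m²))‖Ux^k − x^k‖²`. -/
theorem fejer_inequality_extrapolated_cyclic_cutter
    {H : Type*} [NormedAddCommGroup H] [InnerProductSpace ℝ H]
    (m : ℕ) (hm : 1 ≤ m) (U : ℕ → H → H)
    (hcut : ∀ i ∈ Finset.Icc 1 m, ∀ z x : H, U i z = z →
      ⟪U i x - x, z - x⟫ ≥ ‖U i x - x‖ ^ 2)
    (hne : ∃ z : H, ∀ i ∈ Finset.Icc 1 m, U i z = z)
    (S : ℕ → H → H) (hS0 : ∀ x : H, S 0 x = x)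
    (hS : ∀ i, ∀ x : H, S (i + 1) x = U (i + 1) (S i x))
    (σ : H → ℝ)
    (hσ : ∀ x : H, S m x ≠ x → σ x =
      (∑ i ∈ Finset.Icc 1 m, ⟪S m x - S (i - 1) x, S i x - S (i - 1) x⟫) / ‖S m x - x‖ ^ 2)
    (hσfix : ∀ x : H, S m x = x → σ x = 1)
    (ε : ℝ) (hε0 : 0 < ε) (hε1 : ε < 1)
    (lam : ℕ → ℝ) (hlam : ∀ k, lam k ∈ Set.Icc ε (2 - ε))
    (x : ℕ → H) (hrec : ∀ k, x (k + 1) = x k + (lam k * σ (x k)) • (S m (x k) - x k)) :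
    ∀ k, S m (x k) ≠ x k → ∀ z : H, S m z = z →
      ‖x (k + 1) - z‖ ^ 2 ≤
          ‖x k - z‖ ^ 2 - (lam k * (2 - lam k) / 4) *
            (∑ i ∈ Finset.Icc 1 m, ‖S i (x k) - S (i - 1) (x k)‖ ^ 2) ^ 2 /
              ‖S m (x k) - x k‖ ^ 2 ∧
        ‖x k - z‖ ^ 2 - (lam k * (2 - lam k) / 4) *
            (∑ i ∈ Finset.Icc 1 m, ‖S i (x k) - S (i - 1) (x k)‖ ^ 2) ^ 2 /
              ‖S m (x k) - x k‖ ^ 2 ≤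
          ‖x k - z‖ ^ 2 - (lam k * (2 - lam k) / (4 * (m : ℝ) ^ 2)) *
            ‖S m (x k) - x k‖ ^ 2 := by
  intro k hk z hz
  have hzfix : ∀ i ∈ Finset.Icc 1 m, U i z = z := by
    obtain ⟨w, hw⟩ := hne
    have h := fejer_aux_quasi m U hcut S hS0 hS w hw z
    rw [hz, sub_self] at h
    have h0 := (Finset.sum_eq_zero_iff_of_nonneg
      (fun i _ => sq_nonneg ‖S i z - S (i - 1) z‖)).1
      (le_antisymm h (Finset.sum_nonneg (fun i _ => sq_nonneg _)))
    have h1 : ∀ j, j + 1 ≤ m → S (j + 1) z = S j z := by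
      intro j hj
      have := h0 (j + 1) (Finset.mem_Icc.2 ⟨by omega, hj⟩)
      simpa [sub_eq_zero] using this
    have h2 : ∀ j, j ≤ m → S j z = z := by
      intro j
      induction j with
      | zero => intro _; exact hS0 z
      | succ j ih => intro hj; rw [h1 j hj, ih (by omega)]
    intro i hi
    obtain ⟨h3, h4⟩ := Finset.mem_Icc.1 hi
    obtain ⟨j, rfl⟩ : ∃ j, i = j + 1 := ⟨i - 1, by omega⟩
    have h5 := hS j z
    rw [h2 _ h4, h2 j (by omega)] at h5
    exact h5.symm
  have hq := fejer_aux_quasi m U hcut S hS0 hS z hzfix (x k)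
  have hs := fejer_aux_sum (fun i => S i (x k)) (S m (x k)) m
  have hn := fejer_aux_norm (fun i => S i (x k)) m
  have hsig := hσ (x k) hk
  simp only [hS0, sub_self, norm_zero] at hs hn
  have hN : 0 ≤ ∑ i ∈ Finset.Icc 1 m, ‖S i (x k) - S (i - 1) (x k)‖ ^ 2 :=
    Finset.sum_nonneg (fun i _ => sq_nonneg _)
  obtain ⟨hl1, hl2⟩ := hlam k
  have hD : 0 < ‖S m (x k) - x k‖ ^ 2 := by
    have := norm_pos_iff.2 (sub_ne_zero.2 hk)
    positivity
  have hexp : ‖z - S m (x k)‖ ^ 2 = ‖z - x k‖ ^ 2 - 2 * ⟪z - x k, S m (x k) - x k⟫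
      + ‖S m (x k) - x k‖ ^ 2 := by
    rw [← norm_sub_sq_real]; congr 2; abel
  have hx : ‖x (k + 1) - z‖ ^ 2 = ‖x k - z‖ ^ 2
      - 2 * (lam k * σ (x k)) * ⟪z - x k, S m (x k) - x k⟫
      + (lam k * σ (x k)) ^ 2 * ‖S m (x k) - x k‖ ^ 2 := by
    have e : x (k + 1) - z = -((z - x k) - (lam k * σ (x k)) • (S m (x k) - x k)) := by
      rw [hrec]; abel
    rw [e, norm_neg, norm_sub_sq_real, inner_smul_right, norm_smul, mul_pow, Real.norm_eq_abs,
      sq_abs, norm_sub_rev z (x k)]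
    ring
  rw [hx]
  generalize (∑ i ∈ Finset.Icc 1 m, ⟪S m (x k) - S (i - 1) (x k), S i (x k) - S (i - 1) (x k)⟫)
    = A at *
  generalize (∑ i ∈ Finset.Icc 1 m, ‖S i (x k) - S (i - 1) (x k)‖ ^ 2) = N at *
  generalize ‖S m (x k) - x k‖ ^ 2 = D at *
  generalize ⟪z - x k, S m (x k) - x k⟫ = P at *
  generalize lam k = l at *
  generalize σ (x k) = s at *
  have hl0 : 0 < l := by linarith
  have hl3 : 0 < 2 - l := by linarith
  have hll : 0 < l * (2 - l) := mul_pos hl0 hl3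
  have hA : 2 * A = D + N := by linarith
  have hPA : A ≤ P := by linarith
  have hA0 : 0 ≤ A := by linarith
  have hs0 : 0 ≤ s := by rw [hsig]; positivity
  have hsD : s * D = A := by rw [hsig]; field_simp
  have hm0 : (0 : ℝ) < m := by exact_mod_cast hm
  constructor
  · have h1 : l * (2 - l) / 4 * N ^ 2 / D ≤ l * (2 - l) * (s * A) := by
      rw [div_le_iff₀ hD]
      have e : l * (2 - l) * (s * A) * D = l * (2 - l) * A ^ 2 := by rw [← hsD]; ring
      rw [e]
      have : N ^ 2 ≤ 4 * A ^ 2 := by nlinarith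
      nlinarith
    have h2 : (l * s) ^ 2 * D = l ^ 2 * (s * A) := by rw [← hsD]; ring
    have h3 : l * s * A ≤ l * s * P := mul_le_mul_of_nonneg_left hPA (by positivity)
    rw [h2]
    nlinarith
  · have h1 : l * (2 - l) / (4 * (m : ℝ) ^ 2) * D ≤ l * (2 - l) / 4 * N ^ 2 / D := by
      rw [le_div_iff₀ hD, div_mul_eq_mul_div, div_mul_eq_mul_div, div_le_iff₀ (by positivity)]
      have : D ^ 2 ≤ (m * N) ^ 2 := pow_le_pow_left₀ hD.le hn 2
      nlinarith [mul_le_mul_of_nonneg_left this hll.le]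
    linarith
end

section
/- Let H be a real Hilbert space, let U_i : H → H, i = 1,…,m, be cutter operators with ⋂_{i=1}^m Fix U_i ≠ ∅, set U := U_m ⋯ U_1, S_0 := I, S_i := U_i ⋯ U_1, and let σ_max(x) := (Σ_{i=1}^m ⟨Ux − S_{i−1}x, S_i x − S_{i−1}x⟩)/‖Ux − x‖² for x ∉ Fix U, σ_max(x) := 1 otherwise. Let ε ∈ (0,1), λ_k ∈ [ε, 2−ε], x^0 ∈ H arbitrary, and x^{k+1} := x^k + λ_k σ_max(x^k)(Ux^k − x^k). If U − I is demiclosed at 0, then the sequence (x^k) converges weakly to a point x* ∈ Fix U. -/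
open Filter

local notation "⟪" x ", " y "⟫" => @inner ℝ _ _ x y

/-- Bounded sequences in a Hilbert space have weakly convergent subsequences. -/
theorem exists_weak_subseq {H : Type*} [NormedAddCommGroup H] [InnerProductSpace ℝ H]
    [CompleteSpace H] (x : ℕ → H) (C : ℝ) (hC : ∀ k, ‖x k‖ ≤ C) :
    ∃ (y : H) (φ : ℕ → ℕ), StrictMono φ ∧
      ∀ w : H, Tendsto (fun k => ⟪x (φ k), w⟫) atTop (nhds ⟪y, w⟫) := by
  set K : Submodule ℝ H := (Submodule.span ℝ (Set.range x)).topologicalClosure with hK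
  have hKc : IsClosed (K : Set H) := Submodule.isClosed_topologicalClosure _
  have : CompleteSpace K := hKc.completeSpace_coe
  have : TopologicalSpace.SeparableSpace K := by
    have h1 : TopologicalSpace.IsSeparable (K : Set H) := by
      rw [hK, Submodule.topologicalClosure_coe]
      exact ((Set.countable_range x).isSeparable.span).closure
    exact h1.separableSpace
  have hx : ∀ k, x k ∈ K := fun k =>
    Submodule.le_topologicalClosure _ (Submodule.subset_span ⟨k, rfl⟩)
  let v : ℕ → K := fun k => ⟨x k, hx k⟩
  let f : ℕ → WeakDual ℝ K := fun k =>
    StrongDual.toWeakDual (InnerProductSpace.toDual ℝ K (v k))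
  have hf : ∀ k, f k ∈ WeakDual.toStrongDual ⁻¹' Metric.closedBall (0 : StrongDual ℝ K) C := by
    intro k
    have : ‖InnerProductSpace.toDual ℝ K (v k)‖ ≤ C := by
      rw [LinearIsometryEquiv.norm_map]; exact hC k
    exact mem_closedBall_zero_iff.2 this
  obtain ⟨g, -, φ, hφ, hlim⟩ := WeakDual.isSeqCompact_closedBall ℝ K 0 C hf
  let y : K := (InnerProductSpace.toDual ℝ K).symm (WeakDual.toStrongDual g)
  refine ⟨y, φ, hφ, fun w => ?_⟩
  have h1 : Tendsto (fun k => f (φ k) (K.orthogonalProjectionOnto w)) atTop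
      (nhds (g (K.orthogonalProjectionOnto w))) :=
    ((WeakDual.eval_continuous (K.orthogonalProjectionOnto w)).tendsto g).comp hlim
  have h2 : ∀ u : K, ⟪(u : H), w⟫ = ⟪u, K.orthogonalProjectionOnto w⟫ := fun u =>
    (Submodule.inner_orthogonalProjectionOnto_eq_of_mem_left u w).symm
  have h3 : ⟪(y : H), w⟫ = g (K.orthogonalProjectionOnto w) := by
    rw [h2]; exact InnerProductSpace.toDual_symm_apply
  rw [h3]
  refine h1.congr fun k => ?_
  exact (h2 (v (φ k))).symm

theorem cyc_sum_eq {H : Type*} [NormedAddCommGroup H] [InnerProductSpace ℝ H]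
    (y : ℕ → H) (n : ℕ) :
    ∑ i ∈ Finset.range (n + 1), ⟪y (n + 1) - y i, y (i + 1) - y i⟫ =
      ∑ i ∈ Finset.range n, ⟪y n - y i, y (i + 1) - y i⟫ + ⟪y (n + 1) - y n, y n - y 0⟫
        + ‖y (n + 1) - y n‖ ^ 2 := by
  have h1 : ∀ i, ⟪y (n + 1) - y i, y (i + 1) - y i⟫ =
      ⟪y n - y i, y (i + 1) - y i⟫ + ⟪y (n + 1) - y n, y (i + 1) - y i⟫ := by
    intro i
    rw [← inner_add_left]; congr 1; abel
  rw [Finset.sum_range_succ, real_inner_self_eq_norm_sq, Finset.sum_congr rfl (fun i _ => h1 i),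
    Finset.sum_add_distrib, ← inner_sum, Finset.sum_range_sub]

theorem cyc_sum_half {H : Type*} [NormedAddCommGroup H] [InnerProductSpace ℝ H]
    (y : ℕ → H) (n : ℕ) :
    2 * ∑ i ∈ Finset.range n, ⟪y n - y i, y (i + 1) - y i⟫ =
      ‖y n - y 0‖ ^ 2 + ∑ i ∈ Finset.range n, ‖y (i + 1) - y i‖ ^ 2 := by
  induction n with
  | zero => simp
  | succ n ih =>
    rw [cyc_sum_eq, Finset.sum_range_succ]
    have h : ‖y (n + 1) - y 0‖ ^ 2 = ‖y (n + 1) - y n‖ ^ 2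
        + 2 * ⟪y (n + 1) - y n, y n - y 0⟫ + ‖y n - y 0‖ ^ 2 := by
      rw [← norm_add_sq_real]; congr 2; abel
    linarith

theorem cyc_sum_le {H : Type*} [NormedAddCommGroup H] [InnerProductSpace ℝ H]
    (y : ℕ → H) (z : H) (n : ℕ)
    (h : ∀ i < n, ⟪y (i + 1) - y i, z - y i⟫ ≥ ‖y (i + 1) - y i‖ ^ 2) :
    ∑ i ∈ Finset.range n, ⟪y n - y i, y (i + 1) - y i⟫ ≤ ⟪y n - y 0, z - y 0⟫ := by
  induction n with
  | zero => simp
  | succ n ih =>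
    rw [cyc_sum_eq]
    have h1 := ih (fun i hi => h i (by omega))
    have h2 := h n (by omega)
    have h3 : ⟪y (n + 1) - y 0, z - y 0⟫ = ⟪y n - y 0, z - y 0⟫
        + (⟪y (n + 1) - y n, z - y n⟫ + ⟪y (n + 1) - y n, y n - y 0⟫) := by
      rw [← inner_add_right, ← sub_add_sub_cancel (y (n + 1)) (y n) (y 0), inner_add_left]
      rw [sub_add_sub_cancel z (y n) (y 0)]; ring
    linarith

/-- Let `U_1, …, U_m` be cutter operators on a real Hilbert space `H` with
`⋂_{i=1}^m Fix U_i ≠ ∅`, `U := U_m ⋯ U_1`, `S_0 := I`, `S_i := U_i ⋯ U_1`, and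
`σ_max(x) := (Σ_{i=1}^m ⟪Ux − S_{i−1}x, S_i x − S_{i−1}x⟫)/‖Ux − x‖²` for `x ∉ Fix U`,
`σ_max(x) := 1` otherwise.  Let `ε ∈ (0,1)`, `λ_k ∈ [ε, 2−ε]`, `x^0 ∈ H` arbitrary, and
`x^{k+1} := x^k + λ_k σ_max(x^k)(Ux^k − x^k)`.  If `U − I` is demiclosed at `0`, then
`(x^k)` converges weakly to a point `x* ∈ Fix U`. -/
theorem weak_convergence_extrapolated_cyclic_cutter_of_demiclosed
    {H : Type*} [NormedAddCommGroup H] [InnerProductSpace ℝ H] [CompleteSpace H]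
    (m : ℕ) (hm : 1 ≤ m) (U : ℕ → H → H)
    (hcut : ∀ i ∈ Finset.Icc 1 m, ∀ z x : H, U i z = z →
      ⟪U i x - x, z - x⟫ ≥ ‖U i x - x‖ ^ 2)
    (hne : ∃ z : H, ∀ i ∈ Finset.Icc 1 m, U i z = z)
    (S : ℕ → H → H) (hS0 : ∀ x : H, S 0 x = x)
    (hS : ∀ i, ∀ x : H, S (i + 1) x = U (i + 1) (S i x))
    (σ : H → ℝ)
    (hσ : ∀ x : H, S m x ≠ x → σ x =
      (∑ i ∈ Finset.Icc 1 m, ⟪S m x - S (i - 1) x, S i x - S (i - 1) x⟫) / ‖S m x - x‖ ^ 2)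
    (hσfix : ∀ x : H, S m x = x → σ x = 1)
    (ε : ℝ) (hε0 : 0 < ε) (hε1 : ε < 1)
    (lam : ℕ → ℝ) (hlam : ∀ k, lam k ∈ Set.Icc ε (2 - ε))
    (x : ℕ → H) (hrec : ∀ k, x (k + 1) = x k + (lam k * σ (x k)) • (S m (x k) - x k))
    (hdc : ∀ (u : ℕ → H) (y : H),
      (∀ w : H, Tendsto (fun k => ⟪u k, w⟫) atTop (nhds ⟪y, w⟫)) →
      Tendsto (fun k => ‖S m (u k) - u k‖) atTop (nhds 0) →
      S m y = y) :
    ∃ xstar : H, S m xstar = xstar ∧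
      ∀ w : H, Tendsto (fun k => ⟪x k, w⟫) atTop (nhds ⟪xstar, w⟫) := by
  obtain ⟨z0, hz0⟩ := hne
  set N : H → ℝ := fun v => ∑ i ∈ Finset.range m, ⟪S m v - S i v, S (i + 1) v - S i v⟫ with hN
  have hsum : ∀ v, ∑ i ∈ Finset.Icc 1 m, ⟪S m v - S (i - 1) v, S i v - S (i - 1) v⟫ = N v := by
    intro v
    have hI : Finset.Icc 1 m = Finset.Ico (0 + 1) (m + 1) := by
      ext i; simp only [Finset.mem_Icc, Finset.mem_Ico]; omega
    rw [hI, ← Finset.sum_Ico_add', ← Finset.range_eq_Ico]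
    simp only [hN, Nat.add_sub_cancel]
  have hhalf : ∀ v, 2 * N v =
      ‖S m v - v‖ ^ 2 + ∑ i ∈ Finset.range m, ‖S (i + 1) v - S i v‖ ^ 2 := by
    intro v
    have := cyc_sum_half (fun i => S i v) m
    simpa only [hS0] using this
  have hle : ∀ z, (∀ i ∈ Finset.Icc 1 m, U i z = z) → ∀ v, N v ≤ ⟪S m v - v, z - v⟫ := by
    intro z hz v
    have := cyc_sum_le (fun i => S i v) z m (fun i hi => by
      have hi' : i + 1 ∈ Finset.Icc 1 m := by simp; omega
      simp only [hS]
      exact hcut _ hi' z _ (hz _ hi'))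
    simpa only [hS0] using this
  have hfix : ∀ v, S m v = v → ∀ i ∈ Finset.Icc 1 m, U i v = v := by
    intro v hv
    have h1 := hle z0 hz0 v
    have h2 := hhalf v
    rw [hv] at h1 h2
    simp only [sub_self, inner_zero_left, norm_zero] at h1 h2
    have h0 : ∀ i ∈ Finset.range m, 0 ≤ ‖S (i + 1) v - S i v‖ ^ 2 := fun i _ => by positivity
    have h3 : ∑ i ∈ Finset.range m, ‖S (i + 1) v - S i v‖ ^ 2 = 0 :=
      le_antisymm (by linarith) (Finset.sum_nonneg h0)
    rw [Finset.sum_eq_zero_iff_of_nonneg h0] at h3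
    have h4 : ∀ i < m, S (i + 1) v = S i v := fun i hi => by
      have := h3 i (Finset.mem_range.2 hi)
      exact sub_eq_zero.1 (norm_eq_zero.1 (pow_eq_zero_iff two_ne_zero |>.1 this))
    have h5 : ∀ i ≤ m, S i v = v := by
      intro i
      induction i with
      | zero => intro _; exact hS0 v
      | succ i ih => intro hi; rw [h4 i hi, ih (by omega)]
    intro i hi
    obtain ⟨hi1, hi2⟩ := Finset.mem_Icc.1 hi
    obtain ⟨j, rfl⟩ : ∃ j, i = j + 1 := ⟨i - 1, by omega⟩
    have := hS j v
    rw [h5 _ hi2, h5 j (by omega)] at this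
    exact this.symm
  have hhalf' : ∀ v, ‖S m v - v‖ ^ 2 ≤ 2 * N v := by
    intro v
    rw [hhalf v]
    have : 0 ≤ ∑ i ∈ Finset.range m, ‖S (i + 1) v - S i v‖ ^ 2 :=
      Finset.sum_nonneg fun i _ => by positivity
    linarith
  -- the basic properties of σ
  have hσ1 : ∀ v, 1 / 2 ≤ σ v := by
    intro v
    by_cases hv : S m v = v
    · rw [hσfix v hv]; norm_num
    · have hp : 0 < ‖S m v - v‖ := norm_pos_iff.2 (sub_ne_zero.2 hv)
      rw [hσ v hv, hsum, le_div_iff₀ (by positivity)]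
      linarith [hhalf' v]
  have hσ2 : ∀ z, S m z = z → ∀ v, σ v * ‖S m v - v‖ ^ 2 ≤ ⟪S m v - v, z - v⟫ := by
    intro z hz v
    by_cases hv : S m v = v
    · simp [hv]
    · have hp : 0 < ‖S m v - v‖ := norm_pos_iff.2 (sub_ne_zero.2 hv)
      rw [hσ v hv, hsum, div_mul_cancel₀ _ (by positivity)]
      exact hle z (hfix z hz) v
  -- Fejer monotonicity
  have hfej : ∀ z, S m z = z → ∀ k,
      ‖x (k + 1) - z‖ ^ 2 ≤ ‖x k - z‖ ^ 2 - ε ^ 2 / 4 * ‖S m (x k) - x k‖ ^ 2 := by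
    intro z hz k
    have e1 : x (k + 1) - z = (x k - z) + (lam k * σ (x k)) • (S m (x k) - x k) := by
      rw [hrec]; abel
    have e2 : ⟪x k - z, S m (x k) - x k⟫ = - ⟪S m (x k) - x k, z - x k⟫ := by
      rw [real_inner_comm, ← inner_neg_right, neg_sub]
    rw [e1, norm_add_sq_real, inner_smul_right, e2, norm_smul, mul_pow, Real.norm_eq_abs, sq_abs]
    have h1 := hσ2 z hz (x k)
    have h2 := hσ1 (x k)
    obtain ⟨l1, l2⟩ := hlam k
    set s := σ (x k)
    set l := lam k
    set D := ‖S m (x k) - x k‖ ^ 2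
    have hD : 0 ≤ D := by positivity
    have h3 : l * s * (s * D) ≤ l * s * ⟪S m (x k) - x k, z - x k⟫ :=
      mul_le_mul_of_nonneg_left h1 (mul_nonneg (by linarith) (by linarith))
    have h4 : ε ^ 2 ≤ l * (2 - l) := by nlinarith
    have h5 : (1 : ℝ) / 4 ≤ s ^ 2 := by nlinarith
    have h6 : ε ^ 2 * (1 / 4) ≤ l * (2 - l) * s ^ 2 :=
      mul_le_mul h4 h5 (by norm_num) (le_trans (by positivity) h4)
    have h7 := mul_le_mul_of_nonneg_right h6 hD
    nlinarith
  have hanti : ∀ z, S m z = z → Antitone fun k => ‖x k - z‖ ^ 2 := by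
    intro z hz
    refine antitone_nat_of_succ_le fun k => ?_
    have := hfej z hz k
    have : 0 ≤ ε ^ 2 / 4 * ‖S m (x k) - x k‖ ^ 2 := by positivity
    linarith
  have hconv : ∀ z, S m z = z → ∃ L, Tendsto (fun k => ‖x k - z‖ ^ 2) atTop (nhds L) := by
    intro z hz
    exact ⟨_, tendsto_atTop_ciInf (hanti z hz) ⟨0, by rintro _ ⟨k, rfl⟩; positivity⟩⟩
  have hz0S : S m z0 = z0 := by
    have : ∀ i ≤ m, S i z0 = z0 := by
      intro i
      induction i with
      | zero => intro _; exact hS0 z0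
      | succ i ih =>
        intro hi
        rw [hS, ih (by omega)]
        exact hz0 _ (Finset.mem_Icc.2 ⟨by omega, hi⟩)
    exact this m le_rfl
  have hres : Tendsto (fun k => ‖S m (x k) - x k‖) atTop (nhds 0) := by
    obtain ⟨L, hL⟩ := hconv z0 hz0S
    have h1 : Tendsto (fun k => (‖x k - z0‖ ^ 2 - ‖x (k + 1) - z0‖ ^ 2) * (4 / ε ^ 2))
        atTop (nhds 0) := by
      have := (hL.sub (hL.comp (tendsto_add_atTop_nat 1))).mul_const (4 / ε ^ 2)
      simpa using this
    have h2 : Tendsto (fun k => ‖S m (x k) - x k‖ ^ 2) atTop (nhds 0) := by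
      refine squeeze_zero (fun k => by positivity) (fun k => ?_) h1
      have := hfej z0 hz0S k
      rw [mul_div_assoc', le_div_iff₀ (by positivity)]
      linarith
    have h3 := h2.sqrt
    simpa using h3
  have hbd : ∀ k, ‖x k‖ ≤ ‖x 0 - z0‖ + ‖z0‖ := by
    intro k
    have h1 : ‖x k - z0‖ ≤ ‖x 0 - z0‖ :=
      le_of_sq_le_sq (hanti z0 hz0S (Nat.zero_le k)) (norm_nonneg _)
    have h2 : ‖x k‖ ≤ ‖x k - z0‖ + ‖z0‖ := by
      simpa using norm_add_le (x k - z0) z0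
    linarith
  have hclus : ∀ ns : ℕ → ℕ, Tendsto ns atTop atTop → ∃ (y : H) (φ : ℕ → ℕ), S m y = y ∧
      Tendsto (fun k => ns (φ k)) atTop atTop ∧
      ∀ w : H, Tendsto (fun k => ⟪x (ns (φ k)), w⟫) atTop (nhds ⟪y, w⟫) := by
    intro ns hns
    obtain ⟨y, φ, hφ, hy⟩ := exists_weak_subseq (fun k => x (ns k)) _ (fun k => hbd (ns k))
    have ht : Tendsto (fun k => ns (φ k)) atTop atTop := hns.comp hφ.tendsto_atTop
    exact ⟨y, φ, hdc _ y hy (hres.comp ht), ht, hy⟩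
  obtain ⟨p, φ, hp, hφ, hpw⟩ := hclus id tendsto_id
  refine ⟨p, hp, fun w => ?_⟩
  refine tendsto_of_subseq_tendsto fun ns hns => ?_
  obtain ⟨q, ψ, hq, hψ, hqw⟩ := hclus ns hns
  have hpq : q = p := by
    obtain ⟨L1, hL1⟩ := hconv p hp
    obtain ⟨L2, hL2⟩ := hconv q hq
    have e : ∀ k, ⟪x k, q - p⟫ =
        (‖x k - p‖ ^ 2 - ‖x k - q‖ ^ 2 - ‖p‖ ^ 2 + ‖q‖ ^ 2) / 2 := by
      intro k
      rw [norm_sub_sq_real, norm_sub_sq_real, inner_sub_right]; ring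
    have hlim : Tendsto (fun k => ⟪x k, q - p⟫) atTop
        (nhds ((L1 - L2 - ‖p‖ ^ 2 + ‖q‖ ^ 2) / 2)) := by
      simp only [e]
      exact (((hL1.sub hL2).sub_const _).add_const _).div_const _
    have a1 := tendsto_nhds_unique (hlim.comp hφ) (hpw (q - p))
    have a2 := tendsto_nhds_unique (hlim.comp hψ) (hqw (q - p))
    have a3 : ⟪q - p, q - p⟫ = 0 := by
      rw [inner_sub_left]; linarith
    exact sub_eq_zero.1 (inner_self_eq_zero.1 a3)
  subst hpq
  exact ⟨ψ, hqw w⟩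
end

section
/- Let H be a real Hilbert space, let U_i : H → H, i = 1,…,m, be cutter operators with ⋂_{i=1}^m Fix U_i ≠ ∅ such that U_i − I is demiclosed at 0 for every i = 1,…,m. Set U := U_m ⋯ U_1, S_0 := I, S_i := U_i ⋯ U_1, and let σ_max(x) := (Σ_{i=1}^m ⟨Ux − S_{i−1}x, S_i x − S_{i−1}x⟩)/‖Ux − x‖² for x ∉ Fix U, σ_max(x) := 1 otherwise. Let ε ∈ (0,1), λ_k ∈ [ε, 2−ε], x^0 ∈ H arbitrary, and x^{k+1} := x^k + λ_k σ_max(x^k)(Ux^k − x^k). Then the sequence (x^k) converges weakly to a point x* ∈ Fix U = ⋂_{i=1}^m Fix U_i. -/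
open Filter

local notation "⟪" x ", " y "⟫" => @inner ℝ _ _ x y

/-- Bounded sequences in a real Hilbert space have weakly convergent subsequences. -/
theorem aux_weak_subseq {H : Type*} [NormedAddCommGroup H] [InnerProductSpace ℝ H]
    [CompleteSpace H] (u : ℕ → H) (R : ℝ) (hu : ∀ k, ‖u k‖ ≤ R) :
    ∃ (y : H) (φ : ℕ → ℕ), StrictMono φ ∧
      ∀ w : H, Tendsto (fun k => ⟪u (φ k), w⟫) atTop (nhds ⟪y, w⟫) := by
  set K : Submodule ℝ H := (Submodule.span ℝ (Set.range u)).topologicalClosure with hK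
  have hmem : ∀ k, u k ∈ K := fun k =>
    Submodule.le_topologicalClosure _ (Submodule.subset_span ⟨k, rfl⟩)
  have hcl : IsClosed (K : Set H) := Submodule.isClosed_topologicalClosure _
  have : CompleteSpace K := hcl.completeSpace_coe
  have hsep : TopologicalSpace.IsSeparable (K : Set H) := by
    rw [hK, Submodule.topologicalClosure_coe]
    exact ((Set.countable_range u).isSeparable.span).closure
  have : TopologicalSpace.SeparableSpace K := hsep.separableSpace
  let v : ℕ → K := fun k => ⟨u k, hmem k⟩
  let f : ℕ → WeakDual ℝ K := fun k =>
    StrongDual.toWeakDual (InnerProductSpace.toDual ℝ K (v k))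
  have hf : ∀ k, f k ∈ WeakDual.toStrongDual ⁻¹' Metric.closedBall (0 : StrongDual ℝ K) R := by
    intro k
    have : ‖InnerProductSpace.toDual ℝ K (v k)‖ ≤ R := by
      rw [LinearIsometryEquiv.norm_map]
      exact hu k
    show InnerProductSpace.toDual ℝ K (v k) ∈ Metric.closedBall (0 : StrongDual ℝ K) R
    rw [mem_closedBall_zero_iff]
    exact this
  obtain ⟨g, -, φ, hφ, hlim⟩ := WeakDual.isSeqCompact_closedBall ℝ K 0 R hf
  refine ⟨((InnerProductSpace.toDual ℝ K).symm (WeakDual.toStrongDual g) : K), φ, hφ, ?_⟩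
  intro w
  have h1 := (WeakDual.eval_continuous (𝕜 := ℝ) (K.orthogonalProjectionOnto w)).tendsto g
  have h2 := h1.comp hlim
  have e1 : ∀ k : K, ⟪(k : H), w⟫ = ⟪k, K.orthogonalProjectionOnto w⟫ := by
    intro k
    simp
  rw [e1, InnerProductSpace.toDual_symm_apply]
  refine h2.congr ?_
  intro k
  have := e1 (v (φ k))
  simp only [v] at this
  rw [this]
  simp [f, v]

theorem aux_bsub {H : Type*} [NormedAddCommGroup H] [InnerProductSpace ℝ H] (a p q : H) :
    ⟪q - p, a - p⟫ = (‖a - p‖ ^ 2 - ‖a - q‖ ^ 2 + ‖q - p‖ ^ 2) / 2 := by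
  have : a - q = (a - p) - (q - p) := by abel
  rw [this, norm_sub_sq_real (a - p) (q - p), real_inner_comm]
  ring

theorem aux_tele (f : ℕ → ℝ) (m : ℕ) :
    ∑ i ∈ Finset.Icc 1 m, (f (i - 1) - f i) = f 0 - f m := by
  induction m with
  | zero => simp
  | succ n ih => rw [Finset.sum_Icc_succ_top (by omega), ih]; simp

/-- Opial-type argument. -/
theorem aux_opial {H : Type*} [NormedAddCommGroup H] [InnerProductSpace ℝ H]
    [CompleteSpace H] (x : ℕ → H) (F : Set H) (hF : F.Nonempty)
    (hconv : ∀ z ∈ F, ∃ l, Tendsto (fun k => ‖x k - z‖ ^ 2) atTop (nhds l))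
    (hclus : ∀ (φ : ℕ → ℕ) (y : H), Tendsto φ atTop atTop →
      (∀ w : H, Tendsto (fun k => ⟪x (φ k), w⟫) atTop (nhds ⟪y, w⟫)) → y ∈ F) :
    ∃ y ∈ F, ∀ w : H, Tendsto (fun k => ⟪x k, w⟫) atTop (nhds ⟪y, w⟫) := by
  obtain ⟨z, hz⟩ := hF
  obtain ⟨R, hR⟩ : ∃ R, ∀ k, ‖x k‖ ≤ R := by
    obtain ⟨l, hl⟩ := hconv z hz
    obtain ⟨M, hM⟩ := hl.bddAbove_range
    refine ⟨M + 1 + ‖z‖, fun k => ?_⟩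
    have h1 : ‖x k - z‖ ^ 2 ≤ M := hM ⟨k, rfl⟩
    have h2 : ‖x k‖ ≤ ‖x k - z‖ + ‖z‖ := by
      simpa using norm_add_le (x k - z) z
    nlinarith [sq_nonneg (‖x k - z‖ - 1)]
  obtain ⟨y, φ, hφ, hy⟩ := aux_weak_subseq x R hR
  have hyF := hclus φ y hφ.tendsto_atTop hy
  refine ⟨y, hyF, fun w => ?_⟩
  apply tendsto_of_subseq_tendsto
  intro ns hns
  obtain ⟨y', ψ, hψ, hy'⟩ := aux_weak_subseq (fun k => x (ns k)) R (fun k => hR _)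
  have hn' : Tendsto (fun k => ns (ψ k)) atTop atTop := hns.comp hψ.tendsto_atTop
  have hyF' := hclus (fun k => ns (ψ k)) y' hn' hy'
  have hyy : y = y' := by
    obtain ⟨l, hl⟩ := hconv y hyF
    obtain ⟨l', hl'⟩ := hconv y' hyF'
    have hT : Tendsto (fun k => ⟪x k, y - y'⟫) atTop
        (nhds ((l' - l + (‖y‖ ^ 2 - ‖y'‖ ^ 2)) / 2)) := by
      refine (((hl'.sub hl).add_const (‖y‖ ^ 2 - ‖y'‖ ^ 2)).div_const 2).congr fun k => ?_
      rw [norm_sub_sq_real, norm_sub_sq_real, inner_sub_right]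
      ring
    have a1 := tendsto_nhds_unique (hy (y - y')) (hT.comp hφ.tendsto_atTop)
    have a2 := tendsto_nhds_unique (hy' (y - y')) (hT.comp hn')
    have : ⟪y - y', y - y'⟫ = 0 := by
      rw [inner_sub_left, a1, a2, sub_self]
    exact sub_eq_zero.mp (inner_self_eq_zero.mp this)
  exact ⟨ψ, by rw [hyy]; exact hy' w⟩

/-- Let `U_1, …, U_m` be cutter operators on a real Hilbert space `H` with
`⋂_{i=1}^m Fix U_i ≠ ∅` such that each `U_i − I` is demiclosed at `0`.  With
`U := U_m ⋯ U_1`, `S_0 := I`, `S_i := U_i ⋯ U_1`,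
`σ_max(x) := (Σ_{i=1}^m ⟪Ux − S_{i−1}x, S_i x − S_{i−1}x⟫)/‖Ux − x‖²` for `x ∉ Fix U`,
`σ_max(x) := 1` otherwise, `ε ∈ (0,1)`, `λ_k ∈ [ε, 2−ε]`, `x^0 ∈ H` arbitrary and
`x^{k+1} := x^k + λ_k σ_max(x^k)(Ux^k − x^k)`, the sequence `(x^k)` converges weakly to a
point `x* ∈ Fix U = ⋂_{i=1}^m Fix U_i`. -/
theorem weak_convergence_extrapolated_cyclic_cutter_of_demiclosed_each
    {H : Type*} [NormedAddCommGroup H] [InnerProductSpace ℝ H] [CompleteSpace H]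
    (m : ℕ) (hm : 1 ≤ m) (U : ℕ → H → H)
    (hcut : ∀ i ∈ Finset.Icc 1 m, ∀ z x : H, U i z = z →
      ⟪U i x - x, z - x⟫ ≥ ‖U i x - x‖ ^ 2)
    (hne : ∃ z : H, ∀ i ∈ Finset.Icc 1 m, U i z = z)
    (hdc : ∀ i ∈ Finset.Icc 1 m, ∀ (u : ℕ → H) (y : H),
      (∀ w : H, Tendsto (fun k => ⟪u k, w⟫) atTop (nhds ⟪y, w⟫)) →
      Tendsto (fun k => ‖U i (u k) - u k‖) atTop (nhds 0) →
      U i y = y)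
    (S : ℕ → H → H) (hS0 : ∀ x : H, S 0 x = x)
    (hS : ∀ i, ∀ x : H, S (i + 1) x = U (i + 1) (S i x))
    (σ : H → ℝ)
    (hσ : ∀ x : H, S m x ≠ x → σ x =
      (∑ i ∈ Finset.Icc 1 m, ⟪S m x - S (i - 1) x, S i x - S (i - 1) x⟫) / ‖S m x - x‖ ^ 2)
    (hσfix : ∀ x : H, S m x = x → σ x = 1)
    (ε : ℝ) (hε0 : 0 < ε) (hε1 : ε < 1)
    (lam : ℕ → ℝ) (hlam : ∀ k, lam k ∈ Set.Icc ε (2 - ε))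
    (x : ℕ → H) (hrec : ∀ k, x (k + 1) = x k + (lam k * σ (x k)) • (S m (x k) - x k)) :
    ∃ xstar : H, S m xstar = xstar ∧ (∀ i ∈ Finset.Icc 1 m, U i xstar = xstar) ∧
      ∀ w : H, Tendsto (fun k => ⟪x k, w⟫) atTop (nhds ⟪xstar, w⟫) := by
  -- fixed points of all U_i are fixed by S
  have hSfix : ∀ z, (∀ i ∈ Finset.Icc 1 m, U i z = z) → ∀ j ≤ m, S j z = z := by
    intro z hz j
    induction j with
    | zero => intro _; exact hS0 z
    | succ n ih =>
      intro hn
      rw [hS, ih (by omega)]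
      exact hz _ (Finset.mem_Icc.mpr ⟨by omega, hn⟩)
  have hSi : ∀ i ∈ Finset.Icc 1 m, ∀ p, S i p = U i (S (i - 1) p) := by
    intro i hi p
    obtain ⟨h1, h2⟩ := Finset.mem_Icc.mp hi
    obtain ⟨j, rfl⟩ : ∃ j, i = j + 1 := ⟨i - 1, by omega⟩
    simpa using hS j p
  let Q : H → ℝ := fun p => ∑ i ∈ Finset.Icc 1 m, ‖S i p - S (i - 1) p‖ ^ 2
  have hQ0 : ∀ p, 0 ≤ Q p := fun p => Finset.sum_nonneg fun i _ => sq_nonneg _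
  have hN : ∀ p, ∑ i ∈ Finset.Icc 1 m, ⟪S m p - S (i - 1) p, S i p - S (i - 1) p⟫
      = (‖S m p - p‖ ^ 2 + Q p) / 2 := by
    intro p
    have h1 : ∀ i ∈ Finset.Icc 1 m, ⟪S m p - S (i - 1) p, S i p - S (i - 1) p⟫
        = ((‖S m p - S (i - 1) p‖ ^ 2 - ‖S m p - S i p‖ ^ 2)
          + ‖S i p - S (i - 1) p‖ ^ 2) / 2 := by
      intro i _
      rw [real_inner_comm, aux_bsub]
    rw [Finset.sum_congr rfl h1, ← Finset.sum_div, Finset.sum_add_distrib,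
      aux_tele (fun i => ‖S m p - S i p‖ ^ 2) m]
    simp [hS0, Q]
  have hB : ∀ z, (∀ i ∈ Finset.Icc 1 m, U i z = z) → ∀ p,
      Q p ≤ ‖z - p‖ ^ 2 - ‖z - S m p‖ ^ 2 := by
    intro z hz p
    have h := aux_tele (fun i => ‖z - S i p‖ ^ 2) m
    simp only [hS0] at h
    rw [← h]
    apply Finset.sum_le_sum
    intro i hi
    have hc := hcut i hi z (S (i - 1) p) (hz i hi)
    rw [← hSi i hi, aux_bsub] at hc
    linarith
  have hstep : ∀ z, (∀ i ∈ Finset.Icc 1 m, U i z = z) → ∀ k,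
      ‖x (k + 1) - z‖ ^ 2 ≤ ‖x k - z‖ ^ 2 - ε ^ 2 / 4 * Q (x k) := by
    intro z hz k
    have hb := hB z hz (x k)
    have hq := hQ0 (x k)
    by_cases hd : S m (x k) = x k
    · rw [hd] at hb
      have : Q (x k) = 0 := by linarith
      rw [hrec, hd]
      simp [this]
    · have hdpos : 0 < ‖S m (x k) - x k‖ ^ 2 := by
        have := norm_pos_iff.mpr (sub_ne_zero.mpr hd)
        positivity
      have hs := hσ (x k) hd
      rw [hN] at hs
      have hin := aux_bsub z (x k) (S m (x k))
      obtain ⟨hl1, hl2⟩ := hlam k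
      have hexp : ‖x (k + 1) - z‖ ^ 2 = ‖x k - z‖ ^ 2
          - 2 * (lam k * σ (x k)) * ⟪S m (x k) - x k, z - x k⟫
          + (lam k * σ (x k)) ^ 2 * ‖S m (x k) - x k‖ ^ 2 := by
        have e : x (k + 1) - z
            = (lam k * σ (x k)) • (S m (x k) - x k) - (z - x k) := by
          rw [hrec]; abel
        rw [e, norm_sub_sq_real, real_inner_smul_left, norm_smul, norm_sub_rev z (x k),
          mul_pow, Real.norm_eq_abs, sq_abs]
        ring
      rw [hexp]
      set D := ‖S m (x k) - x k‖ ^ 2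
      set I := ⟪S m (x k) - x k, z - x k⟫
      set q := Q (x k)
      set s := σ (x k)
      set l := lam k
      have hsD : s * D = (D + q) / 2 := by rw [hs]; field_simp
      have hI : (D + q) / 2 ≤ I := by rw [hin]; linarith
      have hs2 : 1 / 2 ≤ s := by
        rw [hs, le_div_iff₀ hdpos]; linarith
      have hl0 : 0 ≤ l := by linarith
      have e1 : l * s * ((D + q) / 2) ≤ l * s * I :=
        mul_le_mul_of_nonneg_left hI (mul_nonneg hl0 (by linarith))
      have e2 : (l * s) ^ 2 * D = l ^ 2 * s * ((D + q) / 2) := by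
        rw [← hsD]; ring
      have e3 : ε ^ 2 ≤ l * (2 - l) := by nlinarith
      have e4 : q / 4 ≤ s * ((D + q) / 2) := by nlinarith
      have e5 : ε ^ 2 * (q / 4) ≤ l * (2 - l) * (s * ((D + q) / 2)) :=
        mul_le_mul e3 e4 (by positivity) (by nlinarith [sq_nonneg ε])
      rw [e2]
      nlinarith
  have hconv : ∀ z, (∀ i ∈ Finset.Icc 1 m, U i z = z) →
      ∃ l, Tendsto (fun k => ‖x k - z‖ ^ 2) atTop (nhds l) := by
    intro z hz
    refine ⟨_, tendsto_atTop_ciInf (antitone_nat_of_succ_le fun k => ?_)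
      ⟨0, by rintro _ ⟨k, rfl⟩; positivity⟩⟩
    have := hstep z hz k
    have := mul_nonneg (by positivity : 0 ≤ ε ^ 2 / 4) (hQ0 (x k))
    linarith
  have hQlim : Tendsto (fun k => Q (x k)) atTop (nhds 0) := by
    obtain ⟨z, hz⟩ := hne
    obtain ⟨l, hl⟩ := hconv z hz
    have h2 := ((hl.sub (hl.comp (tendsto_add_atTop_nat 1))).const_mul (4 / ε ^ 2))
    simp only [sub_self, mul_zero] at h2
    refine squeeze_zero (fun k => hQ0 _) (fun k => ?_) h2
    have := hstep z hz k
    simp only [Function.comp]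
    rw [div_mul_eq_mul_div, le_div_iff₀ (by positivity)]
    linarith
  have hyl : ∀ i ∈ Finset.Icc 1 m,
      Tendsto (fun k => ‖S i (x k) - S (i - 1) (x k)‖) atTop (nhds 0) := by
    intro i hi
    have h1 : Tendsto (fun k => ‖S i (x k) - S (i - 1) (x k)‖ ^ 2) atTop (nhds 0) :=
      squeeze_zero (fun k => sq_nonneg _) (fun k => Finset.single_le_sum
        (f := fun i => ‖S i (x k) - S (i - 1) (x k)‖ ^ 2) (fun i _ => sq_nonneg _) hi) hQlim
    have h2 := h1.sqrt
    simpa [Real.sqrt_sq] using h2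
  obtain ⟨y, hyF, hy⟩ := aux_opial x {z | ∀ i ∈ Finset.Icc 1 m, U i z = z} hne hconv (by
    intro φ y hφ hy
    have hw : ∀ j ≤ m, ∀ w, Tendsto (fun k => ⟪S j (x (φ k)), w⟫) atTop (nhds ⟪y, w⟫) := by
      intro j
      induction j with
      | zero => intro _ w; simpa [hS0] using hy w
      | succ n ih =>
        intro hn w
        have h1 := ih (by omega) w
        have h2 := (hyl (n + 1) (Finset.mem_Icc.mpr ⟨by omega, hn⟩)).comp hφ
        have h3 := (tendsto_zero_iff_norm_tendsto_zero.mpr h2).inner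
          (tendsto_const_nhds (x := w)) (𝕜 := ℝ)
        have h4 := h1.add h3
        simp only [inner_zero_left, add_zero] at h4
        refine h4.congr fun k => ?_
        rw [← inner_add_left]
        simp
    intro i hi
    have hi' := Finset.mem_Icc.mp hi
    refine hdc i hi (fun k => S (i - 1) (x (φ k))) y (hw (i - 1) (by omega)) ?_
    refine ((hyl i hi).comp hφ).congr fun k => ?_
    simp only [Function.comp]
    rw [← hSi i hi])
  exact ⟨y, hSfix y hyF m le_rfl, hyF, hy⟩
end

section
/- Let H be a real Hilbert space, let U_i : H → H, i = 1,…,m, be cutter operators with ⋂_{i=1}^m Fix U_i ≠ ∅, set U := U_m ⋯ U_1, S_0 := I, S_i := U_i ⋯ U_1, and let σ_max(x) := (Σ_{i=1}^m ⟨Ux − S_{i−1}x, S_i x − S_{i−1}x⟩)/‖Ux − x‖² for x ∉ Fix U, σ_max(x) := 1 otherwise. Define σ(x) := max((1+m)/(2m), σ_max(x)) and U_σ x := x + σ(x)(Ux − x). Then U_σ is a cutter. -/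
local notation "⟪" x ", " y "⟫" => @inner ℝ _ _ x y

theorem aux_tele_s11 {H : Type*} [NormedAddCommGroup H] [InnerProductSpace ℝ H]
    (s : ℕ → H) (p : H) (k : ℕ) :
    ∑ i ∈ Finset.range k, ⟪p - s i, s (i + 1) - s i⟫ =
      (‖p - s 0‖ ^ 2 - ‖p - s k‖ ^ 2 + ∑ i ∈ Finset.range k, ‖s (i + 1) - s i‖ ^ 2) / 2 := by
  induction k with
  | zero => simp
  | succ k ih =>
    rw [Finset.sum_range_succ, Finset.sum_range_succ, ih]
    have h := norm_sub_sq_real (p - s k) (s (k + 1) - s k)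
    rw [sub_sub_sub_cancel_right] at h
    linarith

theorem aux_low {H : Type*} [NormedAddCommGroup H] [InnerProductSpace ℝ H]
    (s : ℕ → H) (w : H) (k : ℕ)
    (h : ∀ i < k, ‖s (i + 1) - s i‖ ^ 2 ≤ ⟪s (i + 1) - s i, w - s i⟫) :
    (‖s k - s 0‖ ^ 2 + ∑ i ∈ Finset.range k, ‖s (i + 1) - s i‖ ^ 2) / 2
      ≤ ⟪s k - s 0, w - s 0⟫ := by
  induction k with
  | zero => simp
  | succ k ih =>
    have ih' := ih (fun i hi => h i (by omega))
    have hk := h k (by omega)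
    rw [Finset.sum_range_succ]
    have e : s (k + 1) - s 0 = (s k - s 0) + (s (k + 1) - s k) := by abel
    have e2 : w - s k = (w - s 0) - (s k - s 0) := by abel
    rw [e2, inner_sub_right] at hk
    rw [e, norm_add_sq_real, inner_add_left]
    rw [real_inner_comm (s (k + 1) - s k) (s k - s 0)] at *
    linarith

theorem aux_cs {H : Type*} [NormedAddCommGroup H] [InnerProductSpace ℝ H]
    (s : ℕ → H) (k : ℕ) :
    ‖s k - s 0‖ ^ 2 ≤ k * ∑ i ∈ Finset.range k, ‖s (i + 1) - s i‖ ^ 2 := by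
  have h1 : ‖s k - s 0‖ ≤ ∑ i ∈ Finset.range k, ‖s (i + 1) - s i‖ := by
    rw [← Finset.sum_range_sub s k]
    exact norm_sum_le _ _
  have h2 := sq_sum_le_card_mul_sum_sq (s := Finset.range k) (f := fun i => ‖s (i + 1) - s i‖)
  rw [Finset.card_range] at h2
  exact (pow_le_pow_left₀ (norm_nonneg _) h1 2).trans h2

/-- Let `U_1, …, U_m` be cutter operators on a real Hilbert space `H` with
`⋂_{i=1}^m Fix U_i ≠ ∅`, `U := U_m ⋯ U_1`, `S_0 := I`, `S_i := U_i ⋯ U_1`, and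
`σ_max(x) := (Σ_{i=1}^m ⟪Ux − S_{i−1}x, S_i x − S_{i−1}x⟫)/‖Ux − x‖²` for `x ∉ Fix U`,
`σ_max(x) := 1` otherwise.  With `σ(x) := max((1+m)/(2m), σ_max(x))`, the operator
`U_σ x := x + σ(x)(Ux − x)` is a cutter. -/
theorem extrapolated_cyclic_cutter_max_step_is_cutter
    {H : Type*} [NormedAddCommGroup H] [InnerProductSpace ℝ H]
    (m : ℕ) (hm : 1 ≤ m) (U : ℕ → H → H)
    (hcut : ∀ i ∈ Finset.Icc 1 m, ∀ z x : H, U i z = z →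
      ⟪U i x - x, z - x⟫ ≥ ‖U i x - x‖ ^ 2)
    (hne : ∃ z : H, ∀ i ∈ Finset.Icc 1 m, U i z = z)
    (S : ℕ → H → H) (hS0 : ∀ x : H, S 0 x = x)
    (hS : ∀ i, ∀ x : H, S (i + 1) x = U (i + 1) (S i x))
    (σmax : H → ℝ)
    (hσmax : ∀ x : H, S m x ≠ x → σmax x =
      (∑ i ∈ Finset.Icc 1 m, ⟪S m x - S (i - 1) x, S i x - S (i - 1) x⟫) / ‖S m x - x‖ ^ 2)
    (hσmaxfix : ∀ x : H, S m x = x → σmax x = 1)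
    (σ : H → ℝ) (hσ : ∀ x : H, σ x = max ((1 + (m : ℝ)) / (2 * (m : ℝ))) (σmax x))
    (Uσ : H → H) (hUσ : ∀ x : H, Uσ x = x + σ x • (S m x - x)) :
    ∀ z x : H, Uσ z = z → ⟪Uσ x - x, z - x⟫ ≥ ‖Uσ x - x‖ ^ 2 := by
  have hmpos : (0 : ℝ) < m := by exact_mod_cast hm
  have hc : 0 < (1 + (m : ℝ)) / (2 * (m : ℝ)) := by positivity
  have low : ∀ w : H, (∀ i ∈ Finset.Icc 1 m, U i w = w) → ∀ x : H,
      (‖S m x - x‖ ^ 2 + ∑ i ∈ Finset.range m, ‖S (i + 1) x - S i x‖ ^ 2) / 2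
        ≤ ⟪S m x - x, w - x⟫ := by
    intro w hw x
    have := aux_low (fun i => S i x) w m (fun i hi => by
      have hmem : i + 1 ∈ Finset.Icc 1 m := by rw [Finset.mem_Icc]; omega
      have := hcut (i + 1) hmem w (S i x) (hw _ hmem)
      simpa only [hS] using this)
    simpa only [hS0] using this
  intro z x hz
  -- `z` is a common fixed point
  have hSz : S m z = z := by
    rw [hUσ, add_eq_left] at hz
    have hpos : σ z ≠ 0 := by
      rw [hσ]; exact (lt_of_lt_of_le hc (le_max_left _ _)).ne'
    exact sub_eq_zero.mp ((smul_eq_zero.mp hz).resolve_left hpos)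
  have hcom : ∀ i ∈ Finset.Icc 1 m, U i z = z := by
    obtain ⟨w, hw⟩ := hne
    have h := low w hw z
    rw [hSz, sub_self, norm_zero, inner_zero_left] at h
    have h0 : ∑ i ∈ Finset.range m, ‖S (i + 1) z - S i z‖ ^ 2 = 0 :=
      le_antisymm (by linarith) (Finset.sum_nonneg fun _ _ => by positivity)
    rw [Finset.sum_eq_zero_iff_of_nonneg (fun _ _ => by positivity)] at h0
    have h1 : ∀ i < m, S (i + 1) z = S i z := fun i hi =>
      sub_eq_zero.mp (norm_eq_zero.mp (pow_eq_zero_iff two_ne_zero |>.mp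
        (h0 i (Finset.mem_range.mpr hi))))
    have h2 : ∀ i ≤ m, S i z = z := by
      intro i
      induction i with
      | zero => intro _; exact hS0 z
      | succ i ih => intro hi; rw [h1 i (by omega), ih (by omega)]
    intro i hi
    rw [Finset.mem_Icc] at hi
    obtain ⟨j, rfl⟩ : ∃ j, i = j + 1 := ⟨i - 1, by omega⟩
    have h3 := hS j z
    rw [h2 _ hi.2, h2 j (by omega)] at h3
    exact h3.symm
  have hU : Uσ x - x = σ x • (S m x - x) := by rw [hUσ]; abel
  rw [hU]
  by_cases hx : S m x = x
  · simp [hx]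
  have hn : 0 < ‖S m x - x‖ ^ 2 := by
    have := norm_pos_iff.mpr (sub_ne_zero.mpr hx)
    positivity
  have hsum : ∑ i ∈ Finset.Icc 1 m, ⟪S m x - S (i - 1) x, S i x - S (i - 1) x⟫ =
      (‖S m x - x‖ ^ 2 + ∑ i ∈ Finset.range m, ‖S (i + 1) x - S i x‖ ^ 2) / 2 := by
    have h := aux_tele_s11 (fun i => S i x) (S m x) m
    simp only [hS0, sub_self, norm_zero] at h
    have e : Finset.Icc 1 m = Finset.Ico 1 (m + 1) := by
      ext i; simp only [Finset.mem_Icc, Finset.mem_Ico]; omega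
    rw [e, Finset.sum_Ico_eq_sum_range]
    simp only [Nat.add_sub_cancel_left, Nat.add_sub_cancel, add_comm 1]
    rw [h]; ring
  have hcs := aux_cs (fun i => S i x) m
  simp only [hS0] at hcs
  have hl := low z hcom x
  have hsm := hσmax x hx
  rw [hsum] at hsm
  generalize (∑ i ∈ Finset.range m, ‖S (i + 1) x - S i x‖ ^ 2) = Q at *
  have hle : (1 + (m : ℝ)) / (2 * (m : ℝ)) ≤ σmax x := by
    rw [hsm, div_le_div_iff₀ (by positivity) hn]
    nlinarith
  have hs : σ x = σmax x := by rw [hσ, max_eq_right hle]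
  have hs0 : 0 < σ x := by rw [hs]; linarith
  have hkey : σ x * ‖S m x - x‖ ^ 2 ≤ ⟪S m x - x, z - x⟫ := by
    rw [hs, hsm, div_mul_cancel₀ _ hn.ne']; exact hl
  rw [real_inner_smul_left, norm_smul, mul_pow, Real.norm_eq_abs, sq_abs, pow_two, mul_assoc]
  exact mul_le_mul_of_nonneg_left hkey hs0.le
end

section
/- Let H be a real Hilbert space, let a^1,…,a^m ∈ H with a^i ≠ 0 and b_1,…,b_m ∈ ℝ, and suppose the system ⟨a^i, x⟩ = b_i, i = 1,…,m, has a solution. Let U_i x := x − ((⟨a^i,x⟩ − b_i)/‖a^i‖²) a^i be the orthogonal projection onto the hyperplane H(a^i,b_i) = {x : ⟨a^i,x⟩ = b_i}, set U := U_m ⋯ U_1, S_0 := I, S_i := U_i ⋯ U_1, and for x ∉ Fix U let σ_max(x) := (Σ_{i=1}^m ⟨Ux − S_{i−1}x, S_i x − S_{i−1}x⟩)/‖Ux − x‖², σ_max(x) := 1 otherwise. Let ε ∈ (0,1), λ_k ∈ [ε, 2−ε], x^0 ∈ H arbitrary, and x^{k+1} := x^k + λ_k σ_max(x^k)(Ux^k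 − x^k). Then (x^k) converges weakly to a solution of the system ⟨a^i, x⟩ = b_i, i = 1,…,m. -/
open Filter

local notation "⟪" x ", " y "⟫" => @inner ℝ _ _ x y

section aux
variable {H : Type*} [NormedAddCommGroup H] [InnerProductSpace ℝ H]

/-- The projection onto a hyperplane lies in the hyperplane. -/
lemma kacz_step_mem {a : H} (ha : a ≠ 0) (b : ℝ) (s : H) :
    inner ℝ a (s - ((inner ℝ a s - b) / ‖a‖ ^ 2) • a) = b := by
  have h : ‖a‖ ^ 2 ≠ 0 := by
    have := norm_pos_iff.mpr ha
    positivity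
  rw [inner_sub_right, real_inner_smul_right, real_inner_self_eq_norm_sq, div_mul_cancel₀ _ h]
  ring

/-- One projection step: the Pythagorean identity in two forms. -/
lemma kacz_step_pyth {a : H} (ha : a ≠ 0) {b : ℝ} {z : H} (hz : inner ℝ a z = b) (s s' : H)
    (hs' : s' = s - ((inner ℝ a s - b) / ‖a‖ ^ 2) • a) :
    ‖s - z‖ ^ 2 - ‖s' - z‖ ^ 2 = ‖s' - s‖ ^ 2 ∧
    inner ℝ (z - s) (s' - s) = ‖s - z‖ ^ 2 - ‖s' - z‖ ^ 2 := by
  have h0 : inner ℝ (s' - z) (s' - s) = (0 : ℝ) := by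
    have h1 : s' - s = (-((inner ℝ a s - b) / ‖a‖ ^ 2)) • a := by
      rw [hs', neg_smul]; abel
    rw [h1, real_inner_smul_right, real_inner_comm a (s' - z), inner_sub_right, hz, hs', kacz_step_mem ha]
    ring
  have h2 : s - z = (s' - z) - (s' - s) := by abel
  have h3 : ‖s - z‖ ^ 2 = ‖s' - z‖ ^ 2 + ‖s' - s‖ ^ 2 := by
    rw [h2, norm_sub_sq_real, h0]; ring
  have h4 : z - s = (s' - s) - (s' - z) := by abel
  have h5 : inner ℝ (z - s) (s' - s) = ‖s' - s‖ ^ 2 := by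
    rw [h4, inner_sub_left, h0, real_inner_self_eq_norm_sq]; ring
  constructor <;> linarith

lemma kacz_sum_Icc (m : ℕ) (f : ℕ → ℝ) :
    ∑ i ∈ Finset.Icc 1 m, f i = ∑ j ∈ Finset.range m, f (j + 1) := by
  induction m with
  | zero => simp
  | succ n ih => rw [Finset.sum_Icc_succ_top (by omega), ih, Finset.sum_range_succ]

end aux

/-- (Locally accelerated Kaczmarz method.)  Given a consistent system of
linear equations `⟪a^i, x⟫ = b_i`, `i = 1, …, m`, in a real Hilbert space `H` (`a^i ≠ 0`),
let `U_i` be the orthogonal projection onto the hyperplane `{x : ⟪a^i, x⟫ = b_i}`, let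
`U := U_m ⋯ U_1`, `S_0 := I`, `S_i := U_i ⋯ U_1`, and
`σ_max(x) := (Σ_{i=1}^m ⟪Ux − S_{i−1}x, S_i x − S_{i−1}x⟫)/‖Ux − x‖²` for `x ∉ Fix U`,
`σ_max(x) := 1` otherwise.  For `ε ∈ (0,1)`, `λ_k ∈ [ε, 2−ε]`, any `x^0 ∈ H` and
`x^{k+1} := x^k + λ_k σ_max(x^k)(Ux^k − x^k)`, the sequence `(x^k)` converges weakly to a
solution of the system. -/
theorem weak_convergence_accelerated_kaczmarz
    {H : Type*} [NormedAddCommGroup H] [InnerProductSpace ℝ H] [CompleteSpace H]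
    (m : ℕ) (hm : 1 ≤ m) (a : ℕ → H) (b : ℕ → ℝ)
    (ha : ∀ i ∈ Finset.Icc 1 m, a i ≠ 0)
    (hsol : ∃ y : H, ∀ i ∈ Finset.Icc 1 m, ⟪a i, y⟫ = b i)
    (U : ℕ → H → H)
    (hU : ∀ i ∈ Finset.Icc 1 m, ∀ x : H,
      U i x = x - ((⟪a i, x⟫ - b i) / ‖a i‖ ^ 2) • a i)
    (S : ℕ → H → H) (hS0 : ∀ x : H, S 0 x = x)
    (hS : ∀ i, ∀ x : H, S (i + 1) x = U (i + 1) (S i x))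
    (σ : H → ℝ)
    (hσ : ∀ x : H, S m x ≠ x → σ x =
      (∑ i ∈ Finset.Icc 1 m, ⟪S m x - S (i - 1) x, S i x - S (i - 1) x⟫) / ‖S m x - x‖ ^ 2)
    (hσfix : ∀ x : H, S m x = x → σ x = 1)
    (ε : ℝ) (hε0 : 0 < ε) (hε1 : ε < 1)
    (lam : ℕ → ℝ) (hlam : ∀ k, lam k ∈ Set.Icc ε (2 - ε))
    (x : ℕ → H) (hrec : ∀ k, x (k + 1) = x k + (lam k * σ (x k)) • (S m (x k) - x k)) :
    ∃ xstar : H, (∀ i ∈ Finset.Icc 1 m, ⟪a i, xstar⟫ = b i) ∧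
      ∀ w : H, Tendsto (fun k => ⟪x k, w⟫) atTop (nhds ⟪xstar, w⟫) := by
  have hstep : ∀ i, i < m → ∀ y, S (i + 1) y =
      S i y - ((⟪a (i + 1), S i y⟫ - b (i + 1)) / ‖a (i + 1)‖ ^ 2) • a (i + 1) := by
    intro i hi y
    rw [hS, hU _ (Finset.mem_Icc.mpr ⟨by omega, by omega⟩)]
  have ha' : ∀ i, i < m → a (i + 1) ≠ 0 := fun i hi =>
    ha _ (Finset.mem_Icc.mpr ⟨by omega, by omega⟩)
  -- sum of squares identity
  have hQ : ∀ z : H, (∀ i ∈ Finset.Icc 1 m, ⟪a i, z⟫ = b i) → ∀ y, ∀ n, n ≤ m →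
      ∑ j ∈ Finset.range n, ‖S (j + 1) y - S j y‖ ^ 2 = ‖y - z‖ ^ 2 - ‖S n y - z‖ ^ 2 := by
    intro z hz y n
    induction n with
    | zero => intro _; simp [hS0]
    | succ n ih =>
      intro hn
      rw [Finset.sum_range_succ, ih (by omega)]
      have := (kacz_step_pyth (ha' n hn) (hz (n + 1) (Finset.mem_Icc.mpr ⟨by omega, by omega⟩))
        _ _ (hstep n hn y)).1
      linarith
  have hN : ∀ z : H, (∀ i ∈ Finset.Icc 1 m, ⟪a i, z⟫ = b i) → ∀ y p, ∀ n, n ≤ m →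
      ∑ j ∈ Finset.range n, ⟪p - S j y, S (j + 1) y - S j y⟫ =
        ⟪p - z, S n y - y⟫ + (‖y - z‖ ^ 2 - ‖S n y - z‖ ^ 2) := by
    intro z hz y p n
    induction n with
    | zero => intro _; simp [hS0]
    | succ n ih =>
      intro hn
      rw [Finset.sum_range_succ, ih (by omega)]
      have h1 := (kacz_step_pyth (ha' n hn) (hz (n + 1) (Finset.mem_Icc.mpr ⟨by omega, by omega⟩))
        _ _ (hstep n hn y)).2
      have h2 : p - S n y = (p - z) + (z - S n y) := by abel
      have h3 : S (n + 1) y - y = (S n y - y) + (S (n + 1) y - S n y) := by abel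
      rw [h2, h3, inner_add_left, inner_add_right, h1]
      ring
  -- fixed points are solutions
  have hfix : ∀ y, S m y = y → ∀ i ∈ Finset.Icc 1 m, ⟪a i, y⟫ = b i := by
    intro y hy
    obtain ⟨z, hz⟩ := hsol
    have h1 := hQ z hz y m le_rfl
    rw [hy, sub_self] at h1
    have h2 := (Finset.sum_eq_zero_iff_of_nonneg (fun j _ => sq_nonneg _)).mp h1
    have h3 : ∀ j, j < m → S (j + 1) y = S j y := by
      intro j hj
      have := h2 j (Finset.mem_range.mpr hj)
      exact sub_eq_zero.mp (norm_eq_zero.mp (pow_eq_zero_iff (two_ne_zero) |>.mp this))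
    have h4 : ∀ n, n ≤ m → S n y = y := by
      intro n
      induction n with
      | zero => intro _; exact hS0 y
      | succ n ih => intro hn; rw [h3 n hn, ih (by omega)]
    intro i hi
    obtain ⟨hi1, hi2⟩ := Finset.mem_Icc.mp hi
    obtain ⟨j, rfl⟩ : ∃ j, i = j + 1 := ⟨i - 1, by omega⟩
    have h5 := kacz_step_mem (ha' j hi2) (b (j + 1)) (S j y)
    rwa [← hstep j hi2, h4 _ hi2] at h5
  have hcont : ∀ n, n ≤ m → Continuous (S n) := by
    intro n
    induction n with
    | zero =>
      intro _
      have : S 0 = id := funext hS0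
      rw [this]; exact continuous_id
    | succ n ih =>
      intro hn
      have h1 := ih (by omega)
      rw [funext (hstep n hn)]
      fun_prop
  -- basic properties of σ
  have hσ1 : ∀ z : H, (∀ i ∈ Finset.Icc 1 m, ⟪a i, z⟫ = b i) → ∀ y,
      σ y * ‖S m y - y‖ ^ 2 = -⟪y - z, S m y - y⟫ ∧
      ‖S m y - y‖ ^ 2 ≤ 2 * (σ y * ‖S m y - y‖ ^ 2) := by
    intro z hz y
    by_cases hy : S m y = y
    · simp [hy]
    · have hpos : ‖S m y - y‖ ^ 2 ≠ 0 := by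
        have := norm_pos_iff.mpr (sub_ne_zero.mpr hy)
        positivity
      have h1 := hσ y hy
      rw [kacz_sum_Icc] at h1
      simp only [Nat.add_sub_cancel] at h1
      rw [hN z hz y (S m y) m le_rfl] at h1
      have h2 := hQ z hz y m le_rfl
      have h3 : (0 : ℝ) ≤ ∑ j ∈ Finset.range m, ‖S (j + 1) y - S j y‖ ^ 2 :=
        Finset.sum_nonneg (fun j _ => sq_nonneg _)
      have h4 : S m y - z = (y - z) + (S m y - y) := by abel
      rw [h1, div_mul_cancel₀ _ hpos]
      rw [h2] at h3
      have h5 : ‖S m y - z‖ ^ 2 =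
          ‖y - z‖ ^ 2 + 2 * ⟪y - z, S m y - y⟫ + ‖S m y - y‖ ^ 2 := by
        rw [h4, norm_add_sq_real]
      rw [h5] at h3 ⊢
      rw [h4, inner_add_left, real_inner_self_eq_norm_sq]
      constructor <;> linarith
  -- Fejer inequality
  have hfej : ∀ z : H, (∀ i ∈ Finset.Icc 1 m, ⟪a i, z⟫ = b i) → ∀ k,
      ‖x (k + 1) - z‖ ^ 2 ≤ ‖x k - z‖ ^ 2 - ε ^ 2 / 4 * ‖S m (x k) - x k‖ ^ 2 := by
    intro z hz k
    obtain ⟨h1, h2⟩ := hσ1 z hz (x k)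
    obtain ⟨hl1, hl2⟩ := hlam k
    have h3 : x (k + 1) - z = (x k - z) + (lam k * σ (x k)) • (S m (x k) - x k) := by
      rw [hrec]; abel
    have h4 : ‖x (k + 1) - z‖ ^ 2 = ‖x k - z‖ ^ 2
        - lam k * (2 - lam k) * (σ (x k) ^ 2 * ‖S m (x k) - x k‖ ^ 2) := by
      rw [h3, norm_add_sq_real, real_inner_smul_right, norm_smul, mul_pow, Real.norm_eq_abs,
        sq_abs]
      linear_combination 2 * lam k * σ (x k) * h1
    have h5 : ε ^ 2 ≤ lam k * (2 - lam k) := by nlinarith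
    have h6 : ‖S m (x k) - x k‖ ^ 2 / 4 ≤ σ (x k) ^ 2 * ‖S m (x k) - x k‖ ^ 2 := by
      rcases eq_or_ne (‖S m (x k) - x k‖ ^ 2) 0 with h | h
      · rw [h]; simp
      · have hp : 0 < ‖S m (x k) - x k‖ ^ 2 := lt_of_le_of_ne (sq_nonneg _) h.symm
        have : 1 / 2 ≤ σ (x k) := by
          by_contra! hc
          nlinarith
        have : 1 / 4 ≤ σ (x k) ^ 2 := by nlinarith
        nlinarith
    have h7 : ε ^ 2 * (‖S m (x k) - x k‖ ^ 2 / 4) ≤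
        lam k * (2 - lam k) * (σ (x k) ^ 2 * ‖S m (x k) - x k‖ ^ 2) :=
      mul_le_mul h5 h6 (by positivity) ((sq_nonneg ε).trans h5)
    linarith
  have hanti : ∀ z : H, (∀ i ∈ Finset.Icc 1 m, ⟪a i, z⟫ = b i) →
      Antitone (fun k => ‖x k - z‖ ^ 2) := by
    intro z hz
    refine antitone_nat_of_succ_le fun k => ?_
    have := hfej z hz k
    have h' : 0 ≤ ε ^ 2 / 4 * ‖S m (x k) - x k‖ ^ 2 := by positivity
    show ‖x (k + 1) - z‖ ^ 2 ≤ ‖x k - z‖ ^ 2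
    linarith
  obtain ⟨z, hz⟩ := hsol
  -- residuals tend to zero
  have hres : Tendsto (fun k => S m (x k) - x k) atTop (nhds 0) := by
    obtain ⟨l, hl⟩ : ∃ l, Tendsto (fun k => ‖x k - z‖ ^ 2) atTop (nhds l) :=
      ⟨_, tendsto_atTop_ciInf (hanti z hz) ⟨0, by rintro _ ⟨k, rfl⟩; positivity⟩⟩
    have h1 : Tendsto (fun k => (4 / ε ^ 2) * (‖x k - z‖ ^ 2 - ‖x (k + 1) - z‖ ^ 2)) atTop
        (nhds 0) := by
      have := (hl.sub (hl.comp (tendsto_add_atTop_nat 1))).const_mul (4 / ε ^ 2)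
      simpa using this
    have h2 : Tendsto (fun k => ‖S m (x k) - x k‖ ^ 2) atTop (nhds 0) := by
      refine squeeze_zero (fun k => sq_nonneg _) (fun k => ?_) h1
      have := hfej z hz k
      have he : 0 < ε ^ 2 := by positivity
      rw [div_mul_eq_mul_div, le_div_iff₀ he]
      linarith
    have h3 := h2.sqrt
    simp only [Real.sqrt_sq (norm_nonneg _), Real.sqrt_zero] at h3
    exact tendsto_zero_iff_norm_tendsto_zero.mpr h3
  -- everything happens in a finite-dimensional affine subspace
  let V : Submodule ℝ H := Submodule.span ℝ (a '' (Finset.Icc 1 m : Finset ℕ))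
  have hVfin : FiniteDimensional ℝ V :=
    FiniteDimensional.span_of_finite ℝ ((Finset.finite_toSet _).image a)
  have hSV : ∀ y, ∀ n, n ≤ m → S n y - y ∈ V := by
    intro y n
    induction n with
    | zero => intro _; simp [hS0]
    | succ n ih =>
      intro hn
      rw [hstep n hn, sub_right_comm]
      refine V.sub_mem (ih (by omega)) (V.smul_mem _ (Submodule.subset_span ?_))
      exact ⟨n + 1, by simp; omega, rfl⟩
  have hxV : ∀ k, x k - x 0 ∈ V := by
    intro k
    induction k with
    | zero => simp
    | succ k ih =>
      rw [hrec, add_sub_right_comm]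
      exact V.add_mem ih (V.smul_mem _ (hSV _ m le_rfl))
  have hprop : ProperSpace V := FiniteDimensional.proper_real V
  let v : ℕ → V := fun k => ⟨x k - x 0, hxV k⟩
  have hvb : ∀ k, v k ∈ Metric.closedBall (0 : V) (2 * ‖x 0 - z‖) := by
    intro k
    rw [mem_closedBall_zero_iff]
    show ‖x k - x 0‖ ≤ _
    have h1 : ‖x k - z‖ ≤ ‖x 0 - z‖ :=
      (sq_le_sq₀ (norm_nonneg _) (norm_nonneg _)).mp (hanti z hz (Nat.zero_le k))
    have h2 := norm_sub_le (x k - z) (x 0 - z)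
    rw [sub_sub_sub_cancel_right] at h2
    linarith
  obtain ⟨w, -, φ, hφ, hlim⟩ := (isCompact_closedBall (0 : V) (2 * ‖x 0 - z‖)).tendsto_subseq hvb
  have hsub : Tendsto (fun k => x (φ k)) atTop (nhds ((w : H) + x 0)) := by
    have h1 : Tendsto (fun k => ((v (φ k) : V) : H) + x 0) atTop (nhds ((w : H) + x 0)) :=
      ((continuous_subtype_val.tendsto w).comp hlim).add_const _
    simpa [v] using h1
  generalize (w : H) + x 0 = xs at hsub
  have hxs : S m xs = xs := by
    have h1 : Tendsto (fun k => S m (x (φ k)) - x (φ k)) atTop (nhds (S m xs - xs)) :=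
      (((hcont m le_rfl).tendsto xs).comp hsub).sub hsub
    exact sub_eq_zero.mp (tendsto_nhds_unique h1 (hres.comp hφ.tendsto_atTop))
  have hxsol := hfix xs hxs
  refine ⟨xs, hxsol, ?_⟩
  have hconv : Tendsto x atTop (nhds xs) := by
    rw [Metric.tendsto_atTop]
    intro δ hδ
    obtain ⟨K, hK⟩ := Metric.tendsto_atTop.mp hsub δ hδ
    refine ⟨φ K, fun n hn => ?_⟩
    have h1 : ‖x n - xs‖ ≤ ‖x (φ K) - xs‖ :=
      (sq_le_sq₀ (norm_nonneg _) (norm_nonneg _)).mp (hanti xs hxsol hn)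
    have h2 := hK K le_rfl
    rw [dist_eq_norm] at h2 ⊢
    linarith
  intro w
  exact hconv.inner tendsto_const_nhds
end

section
/- Let H be a real Hilbert space, let a^1,…,a^m ∈ H with a^i ≠ 0 and b_1,…,b_m ∈ ℝ, and suppose ⋂_{i=1}^m H(a^i,b_i) ≠ ∅ where H(a^i,b_i) = {x : ⟨a^i,x⟩ = b_i}. Let U_i be the orthogonal projection onto H(a^i,b_i), U := U_m ⋯ U_1, S_0 := I, S_i := U_i ⋯ U_1, and for x ∉ Fix U set σ_max(x) := (Σ_{i=1}^m ⟨Ux − S_{i−1}x, S_i x − S_{i−1}x⟩)/‖Ux − x‖². Writing u^0 := x and u^i := U_i u^{i−1}, one has for x ∉ Fix U: σ_max(x) = (Σ_{i=1}^m (b_i − ⟨a^i,x⟩)(b_i − ⟨a^i,u^{i−1}⟩)/‖a^i‖²)/‖Ux − x‖². -/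
local notation "⟪" x ", " y "⟫" => @inner ℝ _ _ x y

theorem sum_inner_aux {H : Type*} [NormedAddCommGroup H] [InnerProductSpace ℝ H]
    (u : ℕ → H) (c : H) (n : ℕ) :
    ∑ i ∈ Finset.range n, ⟪c - u i, u (i + 1) - u i⟫ =
      ∑ i ∈ Finset.range n, ⟪u (i + 1) - u 0, u (i + 1) - u i⟫ + ⟪c - u n, u n - u 0⟫ := by
  induction n with
  | zero => simp
  | succ n ih =>
    rw [Finset.sum_range_succ, Finset.sum_range_succ, ih]
    simp only [inner_sub_left, inner_sub_right]
    rw [real_inner_comm (u (n + 1)) (u n), real_inner_comm (u (n + 1)) (u 0),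
      real_inner_comm (u n) (u 0)]
    ring

/-- For the cyclic composition `U := U_m ⋯ U_1` of orthogonal projections
`U_i` onto hyperplanes `{x : ⟪a^i, x⟫ = b_i}` (with `a^i ≠ 0` and nonempty intersection),
with `S_0 := I`, `S_i := U_i ⋯ U_1` and `u^{i-1} := S_{i-1} x`, the step size
`σ_max(x) := (Σ_{i=1}^m ⟪Ux − S_{i−1}x, S_i x − S_{i−1}x⟫)/‖Ux − x‖²` satisfies, for
every `x ∉ Fix U`,
`σ_max(x) = (Σ_{i=1}^m (b_i − ⟪a^i, x⟫)(b_i − ⟪a^i, u^{i−1}⟫)/‖a^i‖²)/‖Ux − x‖²`. -/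
theorem sigma_max_formula_hyperplanes
    {H : Type*} [NormedAddCommGroup H] [InnerProductSpace ℝ H]
    (m : ℕ) (hm : 1 ≤ m) (a : ℕ → H) (b : ℕ → ℝ)
    (ha : ∀ i ∈ Finset.Icc 1 m, a i ≠ 0)
    (hsol : ∃ y : H, ∀ i ∈ Finset.Icc 1 m, ⟪a i, y⟫ = b i)
    (U : ℕ → H → H)
    (hU : ∀ i ∈ Finset.Icc 1 m, ∀ x : H,
      U i x = x - ((⟪a i, x⟫ - b i) / ‖a i‖ ^ 2) • a i)
    (S : ℕ → H → H) (hS0 : ∀ x : H, S 0 x = x)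
    (hS : ∀ i, ∀ x : H, S (i + 1) x = U (i + 1) (S i x))
    (x : H) (hx : S m x ≠ x) :
    (∑ i ∈ Finset.Icc 1 m, ⟪S m x - S (i - 1) x, S i x - S (i - 1) x⟫) / ‖S m x - x‖ ^ 2 =
      (∑ i ∈ Finset.Icc 1 m,
        (b i - ⟪a i, x⟫) * (b i - ⟪a i, S (i - 1) x⟫) / ‖a i‖ ^ 2) / ‖S m x - x‖ ^ 2 := by
  congr 1
  have hI : Finset.Icc 1 m = Finset.Ico 1 (m + 1) := by
    ext i
    simp only [Finset.mem_Icc, Finset.mem_Ico]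
    omega
  have key := sum_inner_aux (fun i => S i x) (S m x) m
  simp only [sub_self, inner_zero_left, add_zero, hS0] at key
  rw [hI, Finset.sum_Ico_eq_sum_range, Finset.sum_Ico_eq_sum_range]
  simp only [Nat.add_sub_cancel, Nat.add_sub_cancel_left, Nat.add_comm 1]
  rw [key]
  refine Finset.sum_congr rfl fun i hi => ?_
  have hmem : i + 1 ∈ Finset.Icc 1 m := by
    simp only [Finset.mem_range] at hi
    simp only [Finset.mem_Icc]
    omega
  have hn : ‖a (i + 1)‖ ≠ 0 := norm_ne_zero_iff.mpr (ha _ hmem)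
  have hstep := hU _ hmem (S i x)
  rw [← hS] at hstep
  have hd : S (i + 1) x - S i x =
      ((b (i + 1) - ⟪a (i + 1), S i x⟫) / ‖a (i + 1)‖ ^ 2) • a (i + 1) := by
    rw [hstep, sub_sub_cancel_left, ← neg_smul]
    congr 1
    ring
  have hb : ⟪a (i + 1), S (i + 1) x⟫ = b (i + 1) := by
    rw [hstep, inner_sub_right, inner_smul_right, real_inner_self_eq_norm_sq]
    field_simp
    ring
  rw [hd, inner_smul_right, real_inner_comm (a (i + 1)) (S (i + 1) x - x), inner_sub_right, hb]
  ring
end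

section
/- Let H be a real Hilbert space, let a^1,…,a^m ∈ H with a^i ≠ 0 and b_1,…,b_m ∈ ℝ, and suppose C := ⋂_{i=1}^m H(a^i,b_i) ≠ ∅ where H(a^i,b_i) = {x : ⟨a^i,x⟩ = b_i}. Let U_i be the orthogonal projection onto H(a^i,b_i), U := U_m ⋯ U_1, S_0 := I, S_i := U_i ⋯ U_1, σ_max(x) := (Σ_{i=1}^m ⟨Ux − S_{i−1}x, S_i x − S_{i−1}x⟩)/‖Ux − x‖² for x ∉ Fix U and 1 otherwise, and U_σ x := x + σ_max(x)(Ux − x). Then for every x ∈ H and every z ∈ C: (a) ⟨U_σ x − x, z − U_σ x⟩ = 0; (b) ‖U_σ x − z‖ = min{‖x + α(Ux − x) − z‖ : α ∈ ℝ}. -/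
local notation "⟪" x ", " y "⟫" => @inner ℝ _ _ x y

/-- For the cyclic composition `U := U_m ⋯ U_1` of orthogonal projections
onto hyperplanes `{x : ⟪a^i, x⟫ = b_i}` with `C := ⋂_{i=1}^m {x : ⟪a^i, x⟫ = b_i} ≠ ∅`,
with `S_0 := I`, `S_i := U_i ⋯ U_1`,
`σ_max(x) := (Σ_{i=1}^m ⟪Ux − S_{i−1}x, S_i x − S_{i−1}x⟫)/‖Ux − x‖²` for `x ∉ Fix U`,
`σ_max(x) := 1` otherwise, and `U_σ x := x + σ_max(x)(Ux − x)`, one has, for every `x ∈ H`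
and every `z ∈ C`:
(a) `⟪U_σ x − x, z − U_σ x⟫ = 0`, and
(b) `‖U_σ x − z‖ = min{‖x + α(Ux − x) − z‖ : α ∈ ℝ}`. -/
theorem extrapolated_kaczmarz_best_on_line
    {H : Type*} [NormedAddCommGroup H] [InnerProductSpace ℝ H]
    (m : ℕ) (hm : 1 ≤ m) (a : ℕ → H) (b : ℕ → ℝ)
    (ha : ∀ i ∈ Finset.Icc 1 m, a i ≠ 0)
    (hsol : ∃ y : H, ∀ i ∈ Finset.Icc 1 m, ⟪a i, y⟫ = b i)
    (U : ℕ → H → H)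
    (hU : ∀ i ∈ Finset.Icc 1 m, ∀ x : H,
      U i x = x - ((⟪a i, x⟫ - b i) / ‖a i‖ ^ 2) • a i)
    (S : ℕ → H → H) (hS0 : ∀ x : H, S 0 x = x)
    (hS : ∀ i, ∀ x : H, S (i + 1) x = U (i + 1) (S i x))
    (σ : H → ℝ)
    (hσ : ∀ x : H, S m x ≠ x → σ x =
      (∑ i ∈ Finset.Icc 1 m, ⟪S m x - S (i - 1) x, S i x - S (i - 1) x⟫) / ‖S m x - x‖ ^ 2)
    (hσfix : ∀ x : H, S m x = x → σ x = 1)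
    (Uσ : H → H) (hUσ : ∀ x : H, Uσ x = x + σ x • (S m x - x)) :
    ∀ x z : H, (∀ i ∈ Finset.Icc 1 m, ⟪a i, z⟫ = b i) →
      ⟪Uσ x - x, z - Uσ x⟫ = 0 ∧
        IsLeast (Set.range fun α : ℝ => ‖x + α • (S m x - x) - z‖) ‖Uσ x - z‖ := by
  intro x z hz
  have hstep : ∀ n, n + 1 ≤ m → ⟪z - S (n + 1) x, S (n + 1) x - S n x⟫ = 0 := by
    intro n hn
    have hmem : n + 1 ∈ Finset.Icc 1 m := by simp; omega
    have hne : ‖a (n + 1)‖ ^ 2 ≠ 0 := pow_ne_zero 2 (norm_ne_zero_iff.mpr (ha _ hmem))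
    have hzz := hz _ hmem
    rw [hS, hU _ hmem]
    set y := S n x
    set t := (⟪a (n + 1), y⟫ - b (n + 1)) / ‖a (n + 1)‖ ^ 2 with ht
    have ht2 : t * ‖a (n + 1)‖ ^ 2 = ⟪a (n + 1), y⟫ - b (n + 1) := by
      rw [ht, div_mul_cancel₀ _ hne]
    have h1 : y - t • a (n + 1) - y = (-t) • a (n + 1) := by module
    rw [h1, inner_smul_right, real_inner_comm, inner_sub_right, inner_sub_right,
      inner_smul_right, real_inner_self_eq_norm_sq, hzz, ht2]
    ring
  have hsum : ∀ v : H, ∀ n, n ≤ m →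
      ∑ i ∈ Finset.Icc 1 n, ⟪v - S (i - 1) x, S i x - S (i - 1) x⟫
        = ⟪z - x, S n x - x⟫ + ⟪v - S n x, S n x - x⟫ := by
    intro v n
    induction n with
    | zero => intro _; simp [hS0]
    | succ n ih =>
      intro hn
      rw [Finset.sum_Icc_succ_top (by omega), ih (by omega)]
      have h := hstep n hn
      simp only [Nat.add_sub_cancel]
      generalize S (n + 1) x = p at *
      generalize S n x = q at *
      simp only [inner_sub_left, inner_sub_right] at h ⊢
      linarith [real_inner_comm p q, real_inner_comm p x, real_inner_comm q x]
  have hD := hsum (S m x) m le_rfl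
  rw [sub_self, inner_zero_left, add_zero] at hD
  have key : ⟪S m x - x, z - Uσ x⟫ = 0 := by
    by_cases hf : S m x = x
    · simp [hf]
    · have hne : ‖S m x - x‖ ^ 2 ≠ 0 := pow_ne_zero 2 (norm_ne_zero_iff.mpr (sub_ne_zero.mpr hf))
      have hs : σ x * ‖S m x - x‖ ^ 2 = ⟪z - x, S m x - x⟫ := by
        rw [hσ x hf, hD, div_mul_cancel₀ _ hne]
      rw [hUσ, ← sub_sub, inner_sub_right, inner_smul_right, real_inner_self_eq_norm_sq, hs,
        real_inner_comm, sub_self]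
  refine ⟨?_, ⟨σ x, ?_⟩, ?_⟩
  · have : Uσ x - x = σ x • (S m x - x) := by rw [hUσ]; abel
    rw [this, inner_smul_left, key, mul_zero]
  · simp only [hUσ]
  · rintro _ ⟨α, rfl⟩
    have h1 : x + α • (S m x - x) - z = (α - σ x) • (S m x - x) - (z - Uσ x) := by
      rw [hUσ]; module
    have h2 : ‖x + α • (S m x - x) - z‖ ^ 2
        = ‖(α - σ x) • (S m x - x)‖ ^ 2 + ‖Uσ x - z‖ ^ 2 := by
      rw [h1, norm_sub_sq_real, inner_smul_left, key, norm_sub_rev z]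
      ring
    refine (sq_le_sq₀ (norm_nonneg _) (norm_nonneg _)).mp ?_
    rw [h2]
    linarith [sq_nonneg ‖(α - σ x) • (S m x - x)‖]
end

section
/- Let H be a real Hilbert space, let a^1,…,a^m ∈ H with a^i ≠ 0 and b_1,…,b_m ∈ ℝ, and suppose C := ⋂_{i=1}^m H_−(a^i,b_i) ≠ ∅ where H_−(a^i,b_i) = {x : ⟨a^i,x⟩ ≤ b_i}. Let U_i x := x − ((⟨a^i,x⟩ − b_i)_+ /‖a^i‖²) a^i be the metric projection onto H_−(a^i,b_i), U := U_m ⋯ U_1, u^0 := x, u^i := U_i u^{i−1}. Then for every x ∈ H and every z ∈ C, ⟨Ux − x, z − x⟩ ≥ Σ_{i=1}^m (⟨a^i,x⟩ − b_i)·(⟨a^i,u^{i−1}⟩ − b_i)_+ /‖a^i‖², where α_+ := max(0,α). -/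
local notation "⟪" x ", " y "⟫" => @inner ℝ _ _ x y

/-- Let `U_i x := x − ((⟪a^i,x⟫ − b_i)_+/‖a^i‖²) a^i` be the metric
projections onto the half-spaces `{x : ⟪a^i, x⟫ ≤ b_i}` (with `a^i ≠ 0` and
`C := ⋂_{i=1}^m {x : ⟪a^i,x⟫ ≤ b_i} ≠ ∅`), let `U := U_m ⋯ U_1` and `u^0 := x`,
`u^i := U_i u^{i−1}`.  Then for every `x ∈ H` and every `z ∈ C`,
`⟪Ux − x, z − x⟫ ≥ Σ_{i=1}^m (⟪a^i,x⟫ − b_i)(⟪a^i,u^{i−1}⟫ − b_i)_+/‖a^i‖²`. -/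
theorem inner_comp_halfspace_projections_ge
    {H : Type*} [NormedAddCommGroup H] [InnerProductSpace ℝ H]
    (m : ℕ) (hm : 1 ≤ m) (a : ℕ → H) (b : ℕ → ℝ)
    (ha : ∀ i ∈ Finset.Icc 1 m, a i ≠ 0)
    (hsol : ∃ y : H, ∀ i ∈ Finset.Icc 1 m, ⟪a i, y⟫ ≤ b i)
    (U : ℕ → H → H)
    (hU : ∀ i ∈ Finset.Icc 1 m, ∀ x : H,
      U i x = x - (max 0 (⟪a i, x⟫ - b i) / ‖a i‖ ^ 2) • a i)
    (S : ℕ → H → H) (hS0 : ∀ x : H, S 0 x = x)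
    (hS : ∀ i, ∀ x : H, S (i + 1) x = U (i + 1) (S i x))
    (x z : H) (hz : ∀ i ∈ Finset.Icc 1 m, ⟪a i, z⟫ ≤ b i) :
    ⟪S m x - x, z - x⟫ ≥
      ∑ i ∈ Finset.Icc 1 m,
        (⟪a i, x⟫ - b i) * max 0 (⟪a i, S (i - 1) x⟫ - b i) / ‖a i‖ ^ 2 := by
  have key : ∀ k, k ≤ m → ⟪S k x - x, z - x⟫ ≥
      ∑ i ∈ Finset.Icc 1 k,
        (⟪a i, x⟫ - b i) * max 0 (⟪a i, S (i - 1) x⟫ - b i) / ‖a i‖ ^ 2 := by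
    intro k
    induction k with
    | zero => intro _; simp [hS0]
    | succ k ih =>
      intro hk
      have ih' := ih (by omega)
      have hmem : k + 1 ∈ Finset.Icc 1 m := Finset.mem_Icc.mpr ⟨by omega, hk⟩
      rw [Finset.sum_Icc_succ_top (by omega), hS, hU _ hmem, Nat.add_sub_cancel]
      have hc : 0 ≤ max 0 (⟪a (k + 1), S k x⟫ - b (k + 1)) / ‖a (k + 1)‖ ^ 2 := by positivity
      rw [mul_div_assoc]
      generalize max 0 (⟪a (k + 1), S k x⟫ - b (k + 1)) / ‖a (k + 1)‖ ^ 2 = c at hc ⊢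
      have e : ⟪S k x - c • a (k + 1) - x, z - x⟫ =
          ⟪S k x - x, z - x⟫ - c * (⟪a (k + 1), z⟫ - ⟪a (k + 1), x⟫) := by
        rw [sub_right_comm, inner_sub_left, real_inner_smul_left, inner_sub_right (a (k + 1))]
      rw [e]
      have h2 := mul_le_mul_of_nonneg_left (hz _ hmem) hc
      linarith
  exact key m le_rfl
end

section
/- Let H be a real Hilbert space, let a^1,…,a^m ∈ H with a^i ≠ 0 and b_1,…,b_m ∈ ℝ, and suppose the system ⟨a^i, x⟩ ≤ b_i, i = 1,…,m, has a solution. Let U_i x := x − ((⟨a^i,x⟩ − b_i)_+ /‖a^i‖²) a^i be the metric projection onto the half-space H_−(a^i,b_i) = {x : ⟨a^i,x⟩ ≤ b_i}, set U := U_m ⋯ U_1, and for x ∉ Fix U with u^0 := x, u^i := U_i u^{i−1}, define σ_max(x) := (Σ_{i=1}^m (⟨a^i,x⟩ − b_i)·(⟨a^i,u^{i−1}⟩ − b_i)_+ /‖a^i‖²)/‖Ux − x‖², and σ_max(x) := 1 for x ∈ Fix U. Let ε ∈ (0,1), λ_k ∈ [ε, 2−ε], x^0 ∈ H arbitrary,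 and x^{k+1} := x^k + λ_k σ_max(x^k)(Ux^k − x^k). Then (x^k) converges weakly to a solution of the system ⟨a^i, x⟩ ≤ b_i, i = 1,…,m. -/
open Filter

local notation "⟪" x ", " y "⟫" => @inner ℝ _ _ x y

/-- A Fejer monotone sequence all of whose weak cluster points lie in `C` converges weakly. -/
theorem fejer_weak {H : Type*} [NormedAddCommGroup H] [InnerProductSpace ℝ H] [CompleteSpace H]
    (C : Set H) (hC : C.Nonempty) (x : ℕ → H)
    (hF : ∀ z ∈ C, ∀ k, ‖x (k + 1) - z‖ ^ 2 ≤ ‖x k - z‖ ^ 2)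
    (hcl : ∀ (F : Ultrafilter ℕ) (y : H), (F : Filter ℕ) ≤ atTop →
      (∀ w : H, Tendsto (fun k => ⟪x k, w⟫) F (nhds ⟪y, w⟫)) → y ∈ C) :
    ∃ y ∈ C, ∀ w : H, Tendsto (fun k => ⟪x k, w⟫) atTop (nhds ⟪y, w⟫) := by
  have hanti : ∀ z ∈ C, Antitone (fun k => ‖x k - z‖ ^ 2) := fun z hz =>
    antitone_nat_of_succ_le (hF z hz)
  have hconv : ∀ z ∈ C, ∃ l, Tendsto (fun k => ‖x k - z‖ ^ 2) atTop (nhds l) := fun z hz =>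
    ⟨_, tendsto_atTop_ciInf (hanti z hz) ⟨0, by rintro _ ⟨k, rfl⟩; positivity⟩⟩
  obtain ⟨z0, hz0⟩ := hC
  have hbd : ∀ k, ‖x k‖ ≤ ‖x 0 - z0‖ + ‖z0‖ := by
    intro k
    have h1 : ‖x k - z0‖ ≤ ‖x 0 - z0‖ :=
      (sq_le_sq₀ (norm_nonneg _) (norm_nonneg _)).1 (hanti z0 hz0 (Nat.zero_le k))
    have h2 : ‖x k‖ ≤ ‖x k - z0‖ + ‖z0‖ := by
      simpa using norm_add_le (x k - z0) z0
    linarith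
  have hex : ∀ F : Ultrafilter ℕ, ∃ y : H,
      ∀ w : H, Tendsto (fun k => ⟪x k, w⟫) F (nhds ⟪y, w⟫) := by
    intro F
    set f : ℕ → WeakDual ℝ H := fun k =>
      StrongDual.toWeakDual (InnerProductSpace.toDual ℝ H (x k)) with hf
    have hK := WeakDual.isCompact_closedBall (𝕜 := ℝ) (E := H) 0 (‖x 0 - z0‖ + ‖z0‖)
    have hmem : ∀ k, f k ∈ (WeakDual.toStrongDual ⁻¹'
        Metric.closedBall (0 : StrongDual ℝ H) (‖x 0 - z0‖ + ‖z0‖)) := by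
      intro k
      have : ‖InnerProductSpace.toDual ℝ H (x k)‖ ≤ ‖x 0 - z0‖ + ‖z0‖ := by
        rw [LinearIsometryEquiv.norm_map]; exact hbd k
      simpa [hf] using this
    obtain ⟨y, -, hy⟩ := hK.ultrafilter_le_nhds (F.map f) (by
      rw [le_principal_iff]
      exact Filter.mem_map.2 (Filter.univ_mem' hmem))
    refine ⟨(InnerProductSpace.toDual ℝ H).symm (WeakDual.toStrongDual y), fun w => ?_⟩
    have h1 : Tendsto f F (nhds y) := hy
    have h2 : Tendsto (fun k => f k w) F (nhds (y w)) :=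
      ((WeakDual.eval_continuous w).tendsto y).comp h1
    have h3 : ⟪(InnerProductSpace.toDual ℝ H).symm (WeakDual.toStrongDual y), w⟫ = y w := by
      rw [InnerProductSpace.toDual_symm_apply]; rfl
    rw [h3]
    exact h2
  have huniq : ∀ (F G : Ultrafilter ℕ) (y z : H), (F : Filter ℕ) ≤ atTop →
      (G : Filter ℕ) ≤ atTop →
      (∀ w : H, Tendsto (fun k => ⟪x k, w⟫) F (nhds ⟪y, w⟫)) →
      (∀ w : H, Tendsto (fun k => ⟪x k, w⟫) G (nhds ⟪z, w⟫)) → y = z := by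
    intro F G y z hFt hGt hy hz
    obtain ⟨l1, hl1⟩ := hconv y (hcl F y hFt hy)
    obtain ⟨l2, hl2⟩ := hconv z (hcl G z hGt hz)
    have hlim : Tendsto (fun k => ⟪x k, y - z⟫) atTop
        (nhds ((l2 - l1 + (‖y‖ ^ 2 - ‖z‖ ^ 2)) / 2)) := by
      have := ((hl2.sub hl1).add_const (‖y‖ ^ 2 - ‖z‖ ^ 2)).div_const 2
      refine this.congr fun k => ?_
      rw [norm_sub_sq_real, norm_sub_sq_real, inner_sub_right]
      ring
    have e1 := tendsto_nhds_unique (hy (y - z)) (hlim.mono_left hFt)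
    have e2 := tendsto_nhds_unique (hz (y - z)) (hlim.mono_left hGt)
    have : ⟪y - z, y - z⟫ = 0 := by rw [inner_sub_left]; linarith
    exact sub_eq_zero.1 (inner_self_eq_zero.1 this)
  obtain ⟨F, hFt⟩ := Ultrafilter.exists_le (atTop : Filter ℕ)
  obtain ⟨y, hy⟩ := hex F
  refine ⟨y, hcl F y hFt hy, fun w => ?_⟩
  rw [tendsto_iff_ultrafilter]
  intro G hG
  obtain ⟨z, hz⟩ := hex G
  have := huniq F G y z hFt hG hy hz
  subst this
  exact hz w

/-- (Locally accelerated cyclic projection method for linear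
inequalities.)  Given a consistent system `⟪a^i, x⟫ ≤ b_i`, `i = 1, …, m`, in a real
Hilbert space `H` (`a^i ≠ 0`), let `U_i x := x − ((⟪a^i,x⟫ − b_i)_+/‖a^i‖²) a^i` be the
metric projections onto the half-spaces, `U := U_m ⋯ U_1`, and, with `u^0 := x`,
`u^i := U_i u^{i−1}`, define
`σ_max(x) := (Σ_{i=1}^m (⟪a^i,x⟫ − b_i)(⟪a^i,u^{i−1}⟫ − b_i)_+/‖a^i‖²)/‖Ux − x‖²` for
`x ∉ Fix U`, `σ_max(x) := 1` otherwise.  For `ε ∈ (0,1)`, `λ_k ∈ [ε, 2−ε]`, any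
`x^0 ∈ H` and `x^{k+1} := x^k + λ_k σ_max(x^k)(Ux^k − x^k)`, the sequence `(x^k)`
converges weakly to a solution of the system. -/
theorem weak_convergence_accelerated_cyclic_projection_inequalities
    {H : Type*} [NormedAddCommGroup H] [InnerProductSpace ℝ H] [CompleteSpace H]
    (m : ℕ) (hm : 1 ≤ m) (a : ℕ → H) (b : ℕ → ℝ)
    (ha : ∀ i ∈ Finset.Icc 1 m, a i ≠ 0)
    (hsol : ∃ y : H, ∀ i ∈ Finset.Icc 1 m, ⟪a i, y⟫ ≤ b i)
    (U : ℕ → H → H)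
    (hU : ∀ i ∈ Finset.Icc 1 m, ∀ x : H,
      U i x = x - (max 0 (⟪a i, x⟫ - b i) / ‖a i‖ ^ 2) • a i)
    (S : ℕ → H → H) (hS0 : ∀ x : H, S 0 x = x)
    (hS : ∀ i, ∀ x : H, S (i + 1) x = U (i + 1) (S i x))
    (σ : H → ℝ)
    (hσ : ∀ x : H, S m x ≠ x → σ x =
      (∑ i ∈ Finset.Icc 1 m,
        (⟪a i, x⟫ - b i) * max 0 (⟪a i, S (i - 1) x⟫ - b i) / ‖a i‖ ^ 2) /
          ‖S m x - x‖ ^ 2)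
    (hσfix : ∀ x : H, S m x = x → σ x = 1)
    (ε : ℝ) (hε0 : 0 < ε) (hε1 : ε < 1)
    (lam : ℕ → ℝ) (hlam : ∀ k, lam k ∈ Set.Icc ε (2 - ε))
    (x : ℕ → H) (hrec : ∀ k, x (k + 1) = x k + (lam k * σ (x k)) • (S m (x k) - x k)) :
    ∃ xstar : H, (∀ i ∈ Finset.Icc 1 m, ⟪a i, xstar⟫ ≤ b i) ∧
      ∀ w : H, Tendsto (fun k => ⟪x k, w⟫) atTop (nhds ⟪xstar, w⟫) := by
  classical
  -- the projection steps
  have step : ∀ n, n + 1 ≤ m → ∀ v : H, S n v - S (n + 1) v =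
      (max 0 (⟪a (n + 1), S n v⟫ - b (n + 1)) / ‖a (n + 1)‖ ^ 2) • a (n + 1) := by
    intro n hn v
    rw [hS, hU (n + 1) (Finset.mem_Icc.2 ⟨by omega, hn⟩)]
    abel
  have hapos : ∀ n, n + 1 ≤ m → 0 < ‖a (n + 1)‖ := fun n hn =>
    norm_pos_iff.2 (ha _ (Finset.mem_Icc.2 ⟨by omega, hn⟩))
  set N : ℕ → H → ℝ := fun n v => ∑ i ∈ Finset.Icc 1 n,
        (⟪a i, v⟫ - b i) * max 0 (⟪a i, S (i - 1) v⟫ - b i) / ‖a i‖ ^ 2 with hN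
  set Q : ℕ → H → ℝ := fun n v => ∑ i ∈ Finset.Icc 1 n, ‖S (i - 1) v - S i v‖ ^ 2 with hQ
  have hNs : ∀ n v, N (n + 1) v = N n v + (⟪a (n + 1), v⟫ - b (n + 1)) *
      max 0 (⟪a (n + 1), S n v⟫ - b (n + 1)) / ‖a (n + 1)‖ ^ 2 := by
    intro n v
    simp only [hN]
    rw [Finset.sum_Icc_succ_top (by omega)]
    simp
  have hQs : ∀ n v, Q (n + 1) v = Q n v + ‖S n v - S (n + 1) v‖ ^ 2 := by
    intro n v
    simp only [hQ]
    rw [Finset.sum_Icc_succ_top (by omega)]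
    simp
  have hN0 : ∀ v, N 0 v = 0 := fun v => by simp [hN]
  have hQ0 : ∀ v, Q 0 v = 0 := fun v => by simp [hQ]
  have hQnn : ∀ n v, 0 ≤ Q n v := fun n v => Finset.sum_nonneg fun i _ => by positivity
  have key1 : ∀ v n, n ≤ m → 2 * N n v = ‖v - S n v‖ ^ 2 + Q n v := by
    intro v n
    induction n with
    | zero => intro _; simp [hN0, hQ0, hS0]
    | succ n ih =>
      intro hn
      have ih := ih (by omega)
      have hp := hapos n hn
      have e : v - S (n + 1) v = (v - S n v) + (S n v - S (n + 1) v) := by abel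
      rw [e, norm_add_sq_real, hNs, hQs, step n hn v, inner_smul_right, norm_smul, mul_pow,
        Real.norm_eq_abs, sq_abs, real_inner_comm (a (n + 1)) (v - S n v), inner_sub_right]
      set A := ‖a (n + 1)‖
      set s := ⟪a (n + 1), S n v⟫
      set r := ⟪a (n + 1), v⟫
      have hmx : max 0 (s - b (n + 1)) * (s - b (n + 1)) = max 0 (s - b (n + 1)) ^ 2 := by
        rcases le_total 0 (s - b (n + 1)) with h | h
        · rw [max_eq_right h]; ring
        · rw [max_eq_left h]; ring
      set p := max 0 (s - b (n + 1))
      have h1 : (r - b (n + 1)) * p / A ^ 2 = p ^ 2 / A ^ 2 + p / A ^ 2 * (r - s) := by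
        rw [← hmx]; ring
      have h2 : (p / A ^ 2) ^ 2 * A ^ 2 = p ^ 2 / A ^ 2 := by
        field_simp
      rw [h1, h2]
      linarith
  have key2 : ∀ z : H, (∀ i ∈ Finset.Icc 1 m, ⟪a i, z⟫ ≤ b i) → ∀ v n, n ≤ m →
      N n v ≤ ⟪v - S n v, v - z⟫ := by
    intro z hz v n
    induction n with
    | zero => intro _; simp [hN0, hS0]
    | succ n ih =>
      intro hn
      have ih := ih (by omega)
      have hp := hapos n hn
      have e : v - S (n + 1) v = (v - S n v) + (S n v - S (n + 1) v) := by abel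
      rw [e, inner_add_left, hNs, step n hn v, real_inner_smul_left,
        inner_sub_right (a (n + 1))]
      have hz' := hz (n + 1) (Finset.mem_Icc.2 ⟨by omega, hn⟩)
      have : (⟪a (n + 1), v⟫ - b (n + 1)) *
          max 0 (⟪a (n + 1), S n v⟫ - b (n + 1)) / ‖a (n + 1)‖ ^ 2 ≤
          max 0 (⟪a (n + 1), S n v⟫ - b (n + 1)) / ‖a (n + 1)‖ ^ 2 *
            (⟪a (n + 1), v⟫ - ⟪a (n + 1), z⟫) := by
        rw [mul_comm, mul_div_right_comm]
        apply mul_le_mul_of_nonneg_left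
        · linarith
        · positivity
      linarith
  have hd : ∀ n, n + 1 ≤ m → ∀ v, ‖S n v - S (n + 1) v‖ ≤ √(Q m v) := by
    intro n hn v
    apply Real.le_sqrt_of_sq_le
    have := Finset.single_le_sum (f := fun i => ‖S (i - 1) v - S i v‖ ^ 2)
      (fun i _ => by positivity) (Finset.mem_Icc.2 ⟨by omega, hn⟩ : n + 1 ∈ Finset.Icc 1 m)
    simpa [hQ] using this
  have key3 : ∀ v n, n ≤ m → ‖v - S n v‖ ≤ n * √(Q m v) := by
    intro v n
    induction n with
    | zero => intro _; simp [hS0]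
    | succ n ih =>
      intro hn
      have ih := ih (by omega)
      have e : v - S (n + 1) v = (v - S n v) + (S n v - S (n + 1) v) := by abel
      rw [e]
      have := norm_add_le (v - S n v) (S n v - S (n + 1) v)
      have := hd n hn v
      push_cast
      linarith
  have key4 : ∀ n, n + 1 ≤ m → ∀ v,
      ⟪a (n + 1), v⟫ - b (n + 1) ≤ ‖a (n + 1)‖ * (n + 1) * √(Q m v) := by
    intro n hn v
    have hp := hapos n hn
    have h1 := hd n hn v
    have h2 := key3 v n (by omega)
    rw [step n hn v, norm_smul, Real.norm_eq_abs, abs_of_nonneg (by positivity)] at h1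
    have h3 : max 0 (⟪a (n + 1), S n v⟫ - b (n + 1)) ≤ ‖a (n + 1)‖ * √(Q m v) := by
      have e : max 0 (⟪a (n + 1), S n v⟫ - b (n + 1)) = ‖a (n + 1)‖ *
        (max 0 (⟪a (n + 1), S n v⟫ - b (n + 1)) / ‖a (n + 1)‖ ^ 2 * ‖a (n + 1)‖) := by
        field_simp
      rw [e]
      exact mul_le_mul_of_nonneg_left h1 hp.le
    have h4 := real_inner_le_norm (a (n + 1)) (v - S n v)
    rw [inner_sub_right] at h4
    have h5 := mul_le_mul_of_nonneg_left h2 hp.le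
    have h6 := le_max_right 0 (⟪a (n + 1), S n v⟫ - b (n + 1))
    linarith
  have key5 : ∀ z : H, (∀ i ∈ Finset.Icc 1 m, ⟪a i, z⟫ ≤ b i) → ∀ k,
      ‖x (k + 1) - z‖ ^ 2 ≤ ‖x k - z‖ ^ 2 - ε ^ 2 / 4 * Q m (x k) := by
    intro z hz k
    have k1 := key1 (x k) m le_rfl
    have k2 := key2 z hz (x k) m le_rfl
    have hq := hQnn m (x k)
    obtain ⟨l1, l2⟩ := hlam k
    by_cases hfix : S m (x k) = x k
    · rw [hrec, hfix]
      rw [hfix] at k1 k2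
      simp at k1 k2
      have : Q m (x k) = 0 := by linarith
      simp [this]
    · have hs := hσ (x k) hfix
      change σ (x k) = N m (x k) / _ at hs
      have hDpos : 0 < ‖S m (x k) - x k‖ := norm_pos_iff.2 (sub_ne_zero.2 hfix)
      rw [norm_sub_rev] at k1
      have e : x (k + 1) - z = (x k - z) + (lam k * σ (x k)) • (S m (x k) - x k) := by
        rw [hrec]; abel
      rw [e, norm_add_sq_real, inner_smul_right, norm_smul, mul_pow, Real.norm_eq_abs, sq_abs,
        real_inner_comm]
      rw [← neg_sub (S m (x k)) (x k), inner_neg_left] at k2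
      set I := ⟪S m (x k) - x k, x k - z⟫
      set D := ‖S m (x k) - x k‖
      set s := σ (x k)
      set l := lam k
      set n := N m (x k)
      set q := Q m (x k)
      have hn : s * D ^ 2 = n := by rw [hs]; field_simp
      have hs2 : 1 / 2 ≤ s := by
        rw [hs, le_div_iff₀ (by positivity)]; linarith
      have hl : ε ^ 2 ≤ l * (2 - l) := by nlinarith
      have hls : 0 ≤ l * s := by
        apply mul_nonneg <;> linarith
      have hsn : q / 4 ≤ s * n := by nlinarith
      have h1 : l * s * I ≤ - (l * s * n) := by nlinarith
      have h2 : (l * s) ^ 2 * D ^ 2 = l ^ 2 * (s * n) := by rw [← hn]; ring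
      have h3 : ε ^ 2 * (q / 4) ≤ l * (2 - l) * (s * n) :=
        mul_le_mul hl hsn (by positivity) (by nlinarith)
      rw [h2]
      nlinarith
  have hQlim : Tendsto (fun k => Q m (x k)) atTop (nhds 0) := by
    obtain ⟨z, hz⟩ := hsol
    have hanti : Antitone (fun k => ‖x k - z‖ ^ 2) := antitone_nat_of_succ_le fun k => by
      have := key5 z hz k
      have := mul_nonneg (by positivity : 0 ≤ ε ^ 2 / 4) (hQnn m (x k))
      linarith
    have hc := tendsto_atTop_ciInf hanti ⟨0, by rintro _ ⟨k, rfl⟩; positivity⟩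
    have hc' := (tendsto_add_atTop_iff_nat 1).2 hc
    have hdiff := (hc.sub hc').const_mul (4 / ε ^ 2)
    rw [sub_self, mul_zero] at hdiff
    refine squeeze_zero (fun k => hQnn m (x k)) (fun k => ?_) hdiff
    have := key5 z hz k
    rw [div_mul_eq_mul_div, le_div_iff₀ (by positivity)]
    linarith
  have hsq : Tendsto (fun k => √(Q m (x k))) atTop (nhds 0) := by
    simpa [Function.comp_def] using (Real.continuous_sqrt.tendsto 0).comp hQlim
  refine fejer_weak {z | ∀ i ∈ Finset.Icc 1 m, ⟪a i, z⟫ ≤ b i} hsol x ?_ ?_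
  · intro z hz k
    have := key5 z hz k
    have := mul_nonneg (by positivity : 0 ≤ ε ^ 2 / 4) (hQnn m (x k))
    linarith
  · intro F y hFt hy i hi
    obtain ⟨hi1, hi2⟩ := Finset.mem_Icc.1 hi
    obtain ⟨n, rfl⟩ : ∃ n, i = n + 1 := ⟨i - 1, by omega⟩
    have h1 := ((hy (a (n + 1))).sub_const (b (n + 1)))
    have h2 := (hsq.mono_left hFt).const_mul (‖a (n + 1)‖ * (n + 1))
    have h3 := le_of_tendsto_of_tendsto' h1 h2 fun k => by
      rw [real_inner_comm]
      exact key4 n hi2 (x k)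
    rw [mul_zero, real_inner_comm] at h3
    linarith
end

section
/- Let H be a real Hilbert space and let c : H → ℝ be a continuous convex function with C := {x ∈ H : c(x) ≤ 0} ≠ ∅. For each x ∈ H let g(x) be a subgradient of c at x, and define the subgradient projector P_c by P_c x := x − ((c(x))_+ /‖g(x)‖²) g(x) if g(x) ≠ 0 and P_c x := x if g(x) = 0. Then P_c is a cutter with Fix P_c = C; in particular, for every z ∈ C and every x ∈ H, ⟨P_c x − x, z − x⟩ ≥ ‖P_c x − x‖². -/
local notation "⟪" x ", " y "⟫" => @inner ℝ _ _ x y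

/-- Let `c : H → ℝ` be a continuous convex function on a real Hilbert
space with `C := {x : c(x) ≤ 0} ≠ ∅`, let `g(x)` be a subgradient of `c` at each `x`, and
let `P_c x := x − ((c x)_+/‖g x‖²) g x` if `g x ≠ 0`, `P_c x := x` otherwise.  Then `P_c`
is a cutter with `Fix P_c = C`: `P_c x = x ↔ c x ≤ 0`, and for every `z ∈ C` and every
`x ∈ H`, `⟪P_c x − x, z − x⟫ ≥ ‖P_c x − x‖²`. -/
theorem subgradient_projector_is_cutter
    {H : Type*} [NormedAddCommGroup H] [InnerProductSpace ℝ H]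
    (c : H → ℝ) (hconv : ConvexOn ℝ Set.univ c) (hcont : Continuous c)
    (hne : ∃ x : H, c x ≤ 0)
    (g : H → H) (hg : ∀ x y : H, ⟪g x, y - x⟫ ≤ c y - c x)
    (P : H → H)
    (hP : ∀ x : H, g x ≠ 0 → P x = x - (max 0 (c x) / ‖g x‖ ^ 2) • g x)
    (hPzero : ∀ x : H, g x = 0 → P x = x) :
    (∀ x : H, P x = x ↔ c x ≤ 0) ∧
      ∀ z x : H, c z ≤ 0 → ⟪P x - x, z - x⟫ ≥ ‖P x - x‖ ^ 2 := by
  constructor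
  · intro x
    by_cases h0 : g x = 0
    · refine ⟨fun _ => ?_, fun _ => hPzero x h0⟩
      obtain ⟨z, hz⟩ := hne
      have h := hg x z
      rw [h0, inner_zero_left] at h
      linarith
    · rw [hP x h0, sub_eq_self, smul_eq_zero]
      have hn : ‖g x‖ ^ 2 ≠ 0 := pow_ne_zero 2 (norm_ne_zero_iff.mpr h0)
      simp [h0]
  · intro z x hz
    by_cases h0 : g x = 0
    · simp [hPzero x h0]
    · have hn : 0 < ‖g x‖ ^ 2 := pow_pos (norm_pos_iff.mpr h0) 2
      have h := hg x z
      have e : P x - x = -((max 0 (c x) / ‖g x‖ ^ 2) • g x) := by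
        rw [hP x h0]; abel
      rw [e, norm_neg, inner_neg_left, real_inner_smul_left, norm_smul, mul_pow,
        Real.norm_eq_abs, sq_abs]
      have hm : 0 ≤ max 0 (c x) := le_max_left _ _
      have hmm : max 0 (c x) * max 0 (c x) = max 0 (c x) * c x := by
        rcases le_total (c x) 0 with hc | hc
        · simp [max_eq_left hc]
        · simp [max_eq_right hc]
      have e2 : (max 0 (c x) / ‖g x‖ ^ 2) ^ 2 * ‖g x‖ ^ 2
          = max 0 (c x) / ‖g x‖ ^ 2 * c x := by
        have : (max 0 (c x) / ‖g x‖ ^ 2) ^ 2 * ‖g x‖ ^ 2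
          = (max 0 (c x) * max 0 (c x)) / ‖g x‖ ^ 2 := by
          field_simp
        rw [this, hmm]; ring
      rw [e2]
      have ht : 0 ≤ max 0 (c x) / ‖g x‖ ^ 2 := div_nonneg hm hn.le
      have := mul_le_mul_of_nonneg_left (show c x ≤ -(inner ℝ (g x) (z - x)) by linarith) ht
      linarith
end

section
/- Let H be a real Hilbert space and let c : H → ℝ be a continuous convex function with {x ∈ H : c(x) ≤ 0} ≠ ∅. For each x ∈ H let g(x) ∈ ∂c(x) be a subgradient selection, and define the subgradient projector P_c by P_c x := x − ((c(x))_+ /‖g(x)‖²) g(x) if g(x) ≠ 0 and P_c x := x if g(x) = 0. If the selection g is bounded on bounded subsets of H, then the operator P_c − I is demiclosed at 0: for any sequence (x^k) converging weakly to x* with ‖P_c x^k − x^k‖ → 0, one has c(x*) ≤ 0, i.e., P_c x* = x*. -/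
open Filter

local notation "⟪" x ", " y "⟫" => @inner ℝ _ _ x y

/-- Let `c : H → ℝ` be a continuous convex function on a real Hilbert
space with `{x : c(x) ≤ 0} ≠ ∅`, let `g(x) ∈ ∂c(x)` be a subgradient selection bounded on
bounded subsets of `H`, and let `P_c x := x − ((c x)_+/‖g x‖²) g x` if `g x ≠ 0`,
`P_c x := x` otherwise.  Then `P_c − I` is demiclosed at `0`: for any sequence `(x^k)`
converging weakly to `x*` with `‖P_c x^k − x^k‖ → 0`, one has `c(x*) ≤ 0`, i.e.
`P_c x* = x*`. -/
theorem subgradient_projector_demiclosed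
    {H : Type*} [NormedAddCommGroup H] [InnerProductSpace ℝ H] [CompleteSpace H]
    (c : H → ℝ) (hconv : ConvexOn ℝ Set.univ c) (hcont : Continuous c)
    (hne : ∃ x : H, c x ≤ 0)
    (g : H → H) (hg : ∀ x y : H, ⟪g x, y - x⟫ ≤ c y - c x)
    (hb : ∀ B : Set H, Bornology.IsBounded B → Bornology.IsBounded (g '' B))
    (P : H → H)
    (hP : ∀ x : H, g x ≠ 0 → P x = x - (max 0 (c x) / ‖g x‖ ^ 2) • g x)
    (hPzero : ∀ x : H, g x = 0 → P x = x)
    (x : ℕ → H) (xstar : H)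
    (hweak : ∀ w : H, Tendsto (fun k => ⟪x k, w⟫) atTop (nhds ⟪xstar, w⟫))
    (hnorm : Tendsto (fun k => ‖P (x k) - x k‖) atTop (nhds 0)) :
    c xstar ≤ 0 ∧ P xstar = xstar := by
  obtain ⟨C, hC⟩ : ∃ C, ∀ k, ‖x k‖ ≤ C := by
    obtain ⟨C, hC⟩ := banach_steinhaus (g := fun k => innerSL ℝ (x k)) (fun w => by
      obtain ⟨C, hC⟩ := (Metric.isBounded_range_of_tendsto _ (hweak w)).exists_norm_le
      exact ⟨C, fun k => by simpa using hC _ ⟨k, rfl⟩⟩)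
    exact ⟨C, fun k => by simpa using hC k⟩
  obtain ⟨M, hM⟩ := (hb (Set.range x)
    (isBounded_iff_forall_norm_le.2 ⟨C, by rintro _ ⟨k, rfl⟩; exact hC k⟩)).exists_norm_le
  have hM' : ∀ k, ‖g (x k)‖ ≤ M := fun k => hM _ ⟨x k, ⟨k, rfl⟩, rfl⟩
  have key : ∀ k, c (x k) ≤ ‖P (x k) - x k‖ * M := by
    intro k
    by_cases h : g (x k) = 0
    · obtain ⟨y, hy⟩ := hne
      have h1 := hg (x k) y
      rw [h, inner_zero_left] at h1
      rw [hPzero _ h]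
      simp only [sub_self, norm_zero, zero_mul]
      linarith
    · have hpos : 0 < ‖g (x k)‖ := norm_pos_iff.2 h
      have hm : 0 ≤ max 0 (c (x k)) := le_max_left _ _
      have h1 : ‖P (x k) - x k‖ * ‖g (x k)‖ = max 0 (c (x k)) := by
        rw [hP _ h, sub_sub_cancel_left, norm_neg, norm_smul, Real.norm_of_nonneg (by positivity)]
        field_simp
      calc c (x k) ≤ max 0 (c (x k)) := le_max_right _ _
        _ = _ := h1.symm
        _ ≤ _ := mul_le_mul_of_nonneg_left (hM' k) (norm_nonneg _)
  have hc : c xstar ≤ 0 := by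
    have t1 : Tendsto (fun k => ‖P (x k) - x k‖ * M - (⟪x k, g xstar⟫ - ⟪xstar, g xstar⟫))
        atTop (nhds (0 * M - (⟪xstar, g xstar⟫ - ⟪xstar, g xstar⟫))) :=
      (hnorm.mul_const M).sub ((hweak (g xstar)).sub_const _)
    rw [zero_mul, sub_self, sub_self] at t1
    refine ge_of_tendsto' t1 fun k => ?_
    have h1 := hg xstar (x k)
    rw [real_inner_comm, inner_sub_left] at h1
    linarith [key k]
  refine ⟨hc, ?_⟩
  by_cases h : g xstar = 0
  · exact hPzero _ h
  · rw [hP _ h, max_eq_left hc]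
    simp
end

section
/- Let H be a real Hilbert space (finite-dimensional, H = ℝⁿ, suffices to ensure subgradients are bounded on bounded sets), let c_i : H → ℝ be continuous convex functions, i = 1,…,m, with C := ⋂_{i=1}^m {x : c_i(x) ≤ 0} ≠ ∅, and let U_i := P_{c_i} be the subgradient projectors U_i x := x − ((c_i(x))_+ /‖g_i(x)‖²) g_i(x) for g_i(x) ∈ ∂c_i(x) nonzero, U_i x := x otherwise, with each selection g_i bounded on bounded sets. Set U := U_m ⋯ U_1, u^0 := x, u^i := U_i u^{i−1}, and for x ∉ Fix U define σ_max(x) := (−Σ_{i=1}^m ((c_i(u^{i−1}))_+ /‖g_i(u^{i−1})‖²) ⟨U_i u^{i−1} − x, g_i(u^{i−1})⟩)/‖Ux − x‖², and σ_max(x) := 1 otherwise. Let ε ∈ (0,1), λ_k ∈ [ε, 2−ε], x^0 ∈ H arbitrary, and x^{k+1} := x^k + λ_k σ_max(x^k)(Ux^k − x^k). Then (x^k) converges weakly to an element of C. -/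
open Filter

local notation "⟪" x ", " y "⟫" => @inner ℝ _ _ x y

/-- Bounded sequences have weak limits along ultrafilters. -/
lemma weak_ultralimit {H : Type*} [NormedAddCommGroup H] [InnerProductSpace ℝ H]
    [CompleteSpace H] (x : ℕ → H) (R : ℝ) (hR : ∀ k, ‖x k‖ ≤ R) (F : Ultrafilter ℕ) :
    ∃ p : H, ∀ w : H, Tendsto (fun k => ⟪x k, w⟫) F (nhds ⟪p, w⟫) := by
  have hex : ∀ w : H, ∃ l : ℝ, l ∈ Set.Icc (-(R * ‖w‖)) (R * ‖w‖) ∧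
      Tendsto (fun k => ⟪x k, w⟫) F (nhds l) := by
    intro w
    have hmem : ∀ k, ⟪x k, w⟫ ∈ Set.Icc (-(R * ‖w‖)) (R * ‖w‖) := by
      intro k
      have h1 := abs_real_inner_le_norm (x k) w
      have h2 : ‖x k‖ * ‖w‖ ≤ R * ‖w‖ := mul_le_mul_of_nonneg_right (hR k) (norm_nonneg w)
      exact abs_le.mp (h1.trans h2)
    have hc : IsCompact (Set.Icc (-(R * ‖w‖)) (R * ‖w‖)) := isCompact_Icc
    obtain ⟨l, hl, hle⟩ := hc.ultrafilter_le_nhds (F.map (fun k => ⟪x k, w⟫)) (by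
      rw [le_principal_iff]
      exact Filter.mem_map.mpr (Filter.univ_mem' hmem))
    exact ⟨l, hl, hle⟩
  choose l hl hlt using hex
  let L : H →ₗ[ℝ] ℝ :=
    { toFun := l
      map_add' := fun a b => by
        refine tendsto_nhds_unique (hlt (a + b)) ?_
        simpa only [inner_add_right] using (hlt a).add (hlt b)
      map_smul' := fun r a => by
        refine tendsto_nhds_unique (hlt (r • a)) ?_
        simpa only [inner_smul_right, smul_eq_mul, RingHom.id_apply] using (hlt a).const_mul r }
  let L' : H →L[ℝ] ℝ := L.mkContinuous R (fun w => by
    rw [Real.norm_eq_abs]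
    exact abs_le.mpr (hl w))
  refine ⟨(InnerProductSpace.toDual ℝ H).symm L', fun w => ?_⟩
  rw [InnerProductSpace.toDual_symm_apply]
  exact hlt w

/-- Opial-type lemma. -/
lemma opial_fejer {H : Type*} [NormedAddCommGroup H] [InnerProductSpace ℝ H]
    [CompleteSpace H] (x : ℕ → H) (C : Set H) (hC : C.Nonempty)
    (hF : ∀ z ∈ C, ∀ k, ‖x (k + 1) - z‖ ^ 2 ≤ ‖x k - z‖ ^ 2)
    (hR : ∃ R : ℝ, ∀ k, ‖x k‖ ≤ R)
    (hcl : ∀ F : Ultrafilter ℕ, (F : Filter ℕ) ≤ atTop → ∀ p : H,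
      (∀ w : H, Tendsto (fun k => ⟪x k, w⟫) F (nhds ⟪p, w⟫)) → p ∈ C) :
    ∃ p ∈ C, ∀ w : H, Tendsto (fun k => ⟪x k, w⟫) atTop (nhds ⟪p, w⟫) := by
  obtain ⟨R, hR⟩ := hR
  have hconv : ∀ z ∈ C, ∃ l, Tendsto (fun k => ‖x k - z‖ ^ 2) atTop (nhds l) := by
    intro z hz
    refine ⟨_, tendsto_atTop_ciInf (antitone_nat_of_succ_le (hF z hz)) ⟨0, ?_⟩⟩
    rintro _ ⟨k, rfl⟩
    positivity
  obtain ⟨p, hp⟩ := weak_ultralimit x R hR (Ultrafilter.of atTop)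
  have hpC : p ∈ C := hcl _ (Ultrafilter.of_le atTop) p hp
  refine ⟨p, hpC, fun w => ?_⟩
  rw [tendsto_iff_ultrafilter]
  intro G hG
  obtain ⟨q, hq⟩ := weak_ultralimit x R hR G
  have hqC : q ∈ C := hcl G hG q hq
  obtain ⟨a, ha⟩ := hconv p hpC
  obtain ⟨b, hb⟩ := hconv q hqC
  have hlim : Tendsto (fun k => ⟪x k, p - q⟫) atTop
      (nhds ((b - a + (‖p‖ ^ 2 - ‖q‖ ^ 2)) / 2)) := by
    have h := ((hb.sub ha).add_const (‖p‖ ^ 2 - ‖q‖ ^ 2)).div_const 2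
    refine h.congr (fun k => ?_)
    rw [norm_sub_sq_real, norm_sub_sq_real, inner_sub_right]
    ring
  have h1 := tendsto_nhds_unique (hp (p - q)) (hlim.mono_left (Ultrafilter.of_le atTop))
  have h2 := tendsto_nhds_unique (hq (p - q)) (hlim.mono_left hG)
  have h3 : ⟪p - q, p - q⟫ = 0 := by
    rw [inner_sub_left, h1, h2, sub_self]
  have h4 : p = q := sub_eq_zero.mp (inner_self_eq_zero.mp h3)
  rw [h4]
  exact hq w

/-- The subgradient projector is a cutter. -/
lemma subgrad_cutter {H : Type*} [NormedAddCommGroup H] [InnerProductSpace ℝ H]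
    (cx cz : ℝ) (g x z : H) (hg : ⟪g, z - x⟫ ≤ cz - cx) (hz : cz ≤ 0) (Ux : H)
    (hU : Ux - x = -((max 0 cx / ‖g‖ ^ 2) • g)) :
    0 ≤ ⟪z - Ux, Ux - x⟫ ∧ max 0 cx ≤ ‖Ux - x‖ * ‖g‖ := by
  by_cases h0 : g = 0
  · subst h0
    simp only [inner_zero_left] at hg
    simp only [smul_zero, neg_zero] at hU
    rw [hU]
    simp
    linarith
  · have hn : 0 < ‖g‖ := norm_pos_iff.mpr h0
    set t := max 0 cx / ‖g‖ ^ 2 with ht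
    have htg : t * ‖g‖ ^ 2 = max 0 cx := by rw [ht]; field_simp
    have ht0 : 0 ≤ t := by positivity
    have hm : t * cx = t * max 0 cx := by
      rcases le_total 0 cx with h | h
      · rw [max_eq_right h]
      · have : t = 0 := by rw [ht, max_eq_left h]; simp
        rw [this]; simp
    constructor
    · have e : z - Ux = (z - x) - (Ux - x) := by abel
      rw [e, inner_sub_left, real_inner_self_eq_norm_sq, hU, norm_neg, norm_smul,
        inner_neg_right, inner_smul_right, real_inner_comm, Real.norm_eq_abs, mul_pow, sq_abs]
      have : t * ⟪g, z - x⟫ ≤ t * (cz - cx) := mul_le_mul_of_nonneg_left hg ht0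
      have h2 : t * cz ≤ 0 := mul_nonpos_of_nonneg_of_nonpos ht0 hz
      have h3 : t ^ 2 * ‖g‖ ^ 2 = t * max 0 cx := by rw [← htg]; ring
      rw [h3]
      linarith
    · rw [hU, norm_neg, norm_smul, Real.norm_eq_abs, abs_of_nonneg ht0, ← htg]
      apply le_of_eq; ring

/-- Telescoping inequality along a chain `u 0, …, u n`. -/
lemma chain_sum {H : Type*} [NormedAddCommGroup H] [InnerProductSpace ℝ H]
    (u : ℕ → H) (n : ℕ) :
    ∑ i ∈ Finset.range n, ⟪u (i + 1) - u 0, u (i + 1) - u i⟫ =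
      (‖u n - u 0‖ ^ 2 + ∑ i ∈ Finset.range n, ‖u (i + 1) - u i‖ ^ 2) / 2 := by
  induction n with
  | zero => simp
  | succ n ih =>
    rw [Finset.sum_range_succ, Finset.sum_range_succ, ih]
    have e : u n - u 0 = (u (n + 1) - u 0) - (u (n + 1) - u n) := by abel
    have := norm_sub_sq_real (u (n + 1) - u 0) (u (n + 1) - u n)
    rw [← e] at this
    rw [this]; ring

lemma chain_cutter {H : Type*} [NormedAddCommGroup H] [InnerProductSpace ℝ H]
    (u : ℕ → H) (z : H) (n : ℕ) (h : ∀ i < n, 0 ≤ ⟪z - u (i + 1), u (i + 1) - u i⟫) :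
    ∑ i ∈ Finset.range n, ⟪u (i + 1) - u 0, u (i + 1) - u i⟫ ≤ ⟪z - u 0, u n - u 0⟫ := by
  have e : u n - u 0 = ∑ i ∈ Finset.range n, (u (i + 1) - u i) := (Finset.sum_range_sub u n).symm
  rw [e, inner_sum]
  refine Finset.sum_le_sum (fun i hi => ?_)
  have h1 := h i (Finset.mem_range.mp hi)
  have e2 : z - u 0 = (z - u (i + 1)) + (u (i + 1) - u 0) := by abel
  rw [e2, inner_add_left]
  linarith

/-- One step of the method. -/
lemma fejer_step {H : Type*} [NormedAddCommGroup H] [InnerProductSpace ℝ H]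
    (x z d : H) (l s N Q ε : ℝ) (hε : 0 < ε) (hl : l ∈ Set.Icc ε (2 - ε))
    (hN : N = (‖d‖ ^ 2 + Q) / 2) (hQ : 0 ≤ Q) (hz : N ≤ ⟪z - x, d⟫)
    (hs : d ≠ 0 → s = N / ‖d‖ ^ 2) :
    ‖x + (l * s) • d - z‖ ^ 2 + ε ^ 2 / 4 * Q ≤ ‖x - z‖ ^ 2 := by
  obtain ⟨hl1, hl2⟩ := hl
  by_cases hd : d = 0
  · subst hd
    simp only [norm_zero, inner_zero_right] at hN hz
    have : Q = 0 := by
      have : (0:ℝ) ^ 2 = 0 := by norm_num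
      rw [this] at hN
      linarith
    simp [this]
  · have hn : 0 < ‖d‖ := norm_pos_iff.mpr hd
    have hs' := hs hd
    have hsN : s * ‖d‖ ^ 2 = N := by rw [hs']; field_simp
    have hs2 : 1 / 2 ≤ s := by
      rw [hs', le_div_iff₀ (by positivity)]
      linarith
    have e : x + (l * s) • d - z = (x - z) + (l * s) • d := by abel
    rw [e, norm_add_sq_real, inner_smul_right, norm_smul, Real.norm_eq_abs, mul_pow, sq_abs]
    have e2 : ⟪x - z, d⟫ = - ⟪z - x, d⟫ := by rw [← inner_neg_left, neg_sub]
    rw [e2]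
    have hN0 : 0 ≤ N := by rw [hN]; positivity
    have hNQ : Q / 2 ≤ N := by rw [hN]; nlinarith [sq_nonneg ‖d‖]
    have h1 : (l * s) * N ≤ (l * s) * ⟪z - x, d⟫ :=
      mul_le_mul_of_nonneg_left hz (by nlinarith)
    have h2 : (l * s) ^ 2 * ‖d‖ ^ 2 = l ^ 2 * s * N := by rw [← hsN]; ring
    rw [h2]
    have h3 : ε ^ 2 ≤ l * (2 - l) := by nlinarith
    have h4 : Q / 4 ≤ s * N := by nlinarith
    have h5 : ε ^ 2 * (Q / 4) ≤ (l * (2 - l)) * (s * N) :=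
      mul_le_mul h3 h4 (by positivity) (by nlinarith [sq_nonneg ε])
    nlinarith

/-- (Locally accelerated cyclic subgradient projection method.)  Let
`c_i : H → ℝ`, `i = 1, …, m`, be continuous convex functions on a real Hilbert space `H`
with `C := ⋂_{i=1}^m {x : c_i(x) ≤ 0} ≠ ∅`, let `U_i := P_{c_i}` be the subgradient
projectors built from subgradient selections `g_i` that are bounded on bounded sets
(this holds automatically when `H = ℝⁿ`).  With `U := U_m ⋯ U_1`, `u^0 := x`,
`u^i := U_i u^{i−1}` (i.e. `u^i = S_i x`), define for `x ∉ Fix U`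
`σ_max(x) := (−Σ_{i=1}^m ((c_i(u^{i−1}))_+/‖g_i(u^{i−1})‖²)⟪U_i u^{i−1} − x, g_i(u^{i−1})⟫)/‖Ux − x‖²`,
and `σ_max(x) := 1` otherwise.  For `ε ∈ (0,1)`, `λ_k ∈ [ε, 2−ε]`, any `x^0 ∈ H` and
`x^{k+1} := x^k + λ_k σ_max(x^k)(Ux^k − x^k)`, the sequence `(x^k)` converges weakly to an
element of `C`. -/
theorem weak_convergence_accelerated_cyclic_subgradient_projection
    {H : Type*} [NormedAddCommGroup H] [InnerProductSpace ℝ H] [CompleteSpace H]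
    (m : ℕ) (hm : 1 ≤ m) (c : ℕ → H → ℝ)
    (hconv : ∀ i ∈ Finset.Icc 1 m, ConvexOn ℝ Set.univ (c i))
    (hcont : ∀ i ∈ Finset.Icc 1 m, Continuous (c i))
    (hsol : ∃ y : H, ∀ i ∈ Finset.Icc 1 m, c i y ≤ 0)
    (g : ℕ → H → H)
    (hg : ∀ i ∈ Finset.Icc 1 m, ∀ x y : H, ⟪g i x, y - x⟫ ≤ c i y - c i x)
    (hb : ∀ i ∈ Finset.Icc 1 m, ∀ B : Set H,
      Bornology.IsBounded B → Bornology.IsBounded (g i '' B))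
    (U : ℕ → H → H)
    (hU : ∀ i ∈ Finset.Icc 1 m, ∀ x : H, g i x ≠ 0 →
      U i x = x - (max 0 (c i x) / ‖g i x‖ ^ 2) • g i x)
    (hUzero : ∀ i ∈ Finset.Icc 1 m, ∀ x : H, g i x = 0 → U i x = x)
    (S : ℕ → H → H) (hS0 : ∀ x : H, S 0 x = x)
    (hS : ∀ i, ∀ x : H, S (i + 1) x = U (i + 1) (S i x))
    (σ : H → ℝ)
    (hσ : ∀ x : H, S m x ≠ x → σ x =
      (-(∑ i ∈ Finset.Icc 1 m,
          (max 0 (c i (S (i - 1) x)) / ‖g i (S (i - 1) x)‖ ^ 2) *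
            ⟪U i (S (i - 1) x) - x, g i (S (i - 1) x)⟫)) / ‖S m x - x‖ ^ 2)
    (hσfix : ∀ x : H, S m x = x → σ x = 1)
    (ε : ℝ) (hε0 : 0 < ε) (hε1 : ε < 1)
    (lam : ℕ → ℝ) (hlam : ∀ k, lam k ∈ Set.Icc ε (2 - ε))
    (x : ℕ → H) (hrec : ∀ k, x (k + 1) = x k + (lam k * σ (x k)) • (S m (x k) - x k)) :
    ∃ xstar : H, (∀ i ∈ Finset.Icc 1 m, c i xstar ≤ 0) ∧
      ∀ w : H, Tendsto (fun k => ⟪x k, w⟫) atTop (nhds ⟪xstar, w⟫) := by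
  have hmem : ∀ i < m, i + 1 ∈ Finset.Icc 1 m := fun i hi => by
    rw [Finset.mem_Icc]; omega
  have hUd : ∀ i ∈ Finset.Icc 1 m, ∀ v : H,
      U i v - v = -((max 0 (c i v) / ‖g i v‖ ^ 2) • g i v) := by
    intro i hi v
    by_cases h0 : g i v = 0
    · rw [hUzero i hi v h0, h0]; simp
    · rw [hU i hi v h0]; abel
  have hcut : ∀ z : H, (∀ i ∈ Finset.Icc 1 m, c i z ≤ 0) → ∀ v : H, ∀ i < m,
      0 ≤ ⟪z - S (i + 1) v, S (i + 1) v - S i v⟫ ∧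
      max 0 (c (i + 1) (S i v)) ≤ ‖S (i + 1) v - S i v‖ * ‖g (i + 1) (S i v)‖ := by
    intro z hz v i hi
    rw [hS i v]
    exact subgrad_cutter _ (c (i + 1) z) _ _ z (hg _ (hmem i hi) _ _) (hz _ (hmem i hi)) _
      (hUd _ (hmem i hi) _)
  -- the numerator
  have hnum : ∀ v : H, -(∑ i ∈ Finset.Icc 1 m,
          (max 0 (c i (S (i - 1) v)) / ‖g i (S (i - 1) v)‖ ^ 2) *
            ⟪U i (S (i - 1) v) - v, g i (S (i - 1) v)⟫) =
      ∑ i ∈ Finset.range m, ⟪S (i + 1) v - S 0 v, S (i + 1) v - S i v⟫ := by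
    intro v
    rw [← Finset.sum_neg_distrib]
    have hIco : Finset.Icc 1 m = Finset.Ico 1 (m + 1) := by
      ext i; simp only [Finset.mem_Icc, Finset.mem_Ico]; omega
    rw [hIco, Finset.sum_Ico_eq_sum_range, Nat.add_sub_cancel]
    refine Finset.sum_congr rfl (fun i hi => ?_)
    have hi' := hmem i (Finset.mem_range.mp hi)
    rw [Nat.add_comm 1 i, Nat.add_sub_cancel, hS i v, hUd _ hi' (S i v), hS0,
      inner_neg_right, inner_smul_right]
  let Q : H → ℝ := fun v => ∑ i ∈ Finset.range m, ‖S (i + 1) v - S i v‖ ^ 2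
  have hQ0 : ∀ v, 0 ≤ Q v := fun v => Finset.sum_nonneg (fun i _ => by positivity)
  have hstep : ∀ z : H, (∀ i ∈ Finset.Icc 1 m, c i z ≤ 0) → ∀ k,
      ‖x (k + 1) - z‖ ^ 2 + ε ^ 2 / 4 * Q (x k) ≤ ‖x k - z‖ ^ 2 := by
    intro z hz k
    rw [hrec k]
    refine fejer_step (x k) z (S m (x k) - x k) (lam k) (σ (x k))
      (∑ i ∈ Finset.range m, ⟪S (i + 1) (x k) - S 0 (x k), S (i + 1) (x k) - S i (x k)⟫)
      (Q (x k)) ε hε0 (hlam k) ?_ (hQ0 _) ?_ ?_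
    · rw [chain_sum (fun i => S i (x k)) m]
      simp only [hS0, Q]
    · have := chain_cutter (fun i => S i (x k)) z m (fun i hi => (hcut z hz (x k) i hi).1)
      simpa only [hS0] using this
    · intro hd
      rw [hσ (x k) (sub_ne_zero.mp hd), hnum]
  have hmono : ∀ z : H, (∀ i ∈ Finset.Icc 1 m, c i z ≤ 0) → ∀ k,
      ‖x (k + 1) - z‖ ^ 2 ≤ ‖x k - z‖ ^ 2 := by
    intro z hz k
    have h1 := hstep z hz k
    have h2 : 0 ≤ ε ^ 2 / 4 * Q (x k) := mul_nonneg (by positivity) (hQ0 _)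
    linarith
  obtain ⟨z, hz⟩ := hsol
  have hanti : Antitone (fun k => ‖x k - z‖ ^ 2) := antitone_nat_of_succ_le (hmono z hz)
  have hbx : ∀ k, ‖x k‖ ≤ ‖x 0 - z‖ + ‖z‖ := by
    intro k
    have h1 : ‖x k - z‖ ≤ ‖x 0 - z‖ :=
      le_of_sq_le_sq (hanti (Nat.zero_le k)) (norm_nonneg _)
    have h2 := norm_add_le (x k - z) z
    rw [sub_add_cancel] at h2
    linarith
  -- Q tends to zero
  have hQlim : Tendsto (fun k => Q (x k)) atTop (nhds 0) := by
    have hl : ∃ l, Tendsto (fun k => ‖x k - z‖ ^ 2) atTop (nhds l) := by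
      refine ⟨_, tendsto_atTop_ciInf hanti ⟨0, ?_⟩⟩
      rintro _ ⟨k, rfl⟩
      positivity
    obtain ⟨l, hl⟩ := hl
    have h1 : Tendsto (fun k => (‖x k - z‖ ^ 2 - ‖x (k + 1) - z‖ ^ 2) * (4 / ε ^ 2)) atTop
        (nhds 0) := by
      have := (hl.sub (hl.comp (tendsto_add_atTop_nat 1))).mul_const (4 / ε ^ 2)
      rw [sub_self, zero_mul] at this
      exact this
    refine squeeze_zero (fun k => hQ0 _) (fun k => ?_) h1
    have h2 := hstep z hz k
    have h3 : Q (x k) = (ε ^ 2 / 4 * Q (x k)) * (4 / ε ^ 2) := by field_simp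
    rw [h3]
    exact mul_le_mul_of_nonneg_right (by linarith) (by positivity)
  have hdiff : ∀ i < m, Tendsto (fun k => ‖S (i + 1) (x k) - S i (x k)‖) atTop (nhds 0) := by
    intro i hi
    have h1 : Tendsto (fun k => √(Q (x k))) atTop (nhds 0) := by
      simpa using hQlim.sqrt
    refine squeeze_zero (fun k => norm_nonneg _) (fun k => ?_) h1
    apply Real.le_sqrt_of_sq_le
    exact Finset.single_le_sum (f := fun i => ‖S (i + 1) (x k) - S i (x k)‖ ^ 2)
      (fun j _ => by positivity) (Finset.mem_range.mpr hi)
  have hdiff0 : ∀ i ≤ m, Tendsto (fun k => S i (x k) - x k) atTop (nhds 0) := by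
    intro i
    induction i with
    | zero => intro _; simp [hS0]
    | succ i ih =>
      intro hi
      have h1 := ih (by omega)
      have h2 := tendsto_zero_iff_norm_tendsto_zero.mpr (hdiff i (by omega))
      have h3 := h2.add h1
      rw [add_zero] at h3
      refine h3.congr (fun k => ?_)
      abel
  have hSb : ∀ i ≤ m, Bornology.IsBounded (Set.range (fun k => S i (x k))) := by
    intro i hi
    have h1 := Metric.isBounded_range_of_tendsto _ (hdiff0 i hi)
    obtain ⟨M, hM⟩ := h1.exists_norm_le
    refine isBounded_iff_forall_norm_le.mpr ⟨M + (‖x 0 - z‖ + ‖z‖), ?_⟩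
    rintro _ ⟨k, rfl⟩
    have h2 := hM _ ⟨k, rfl⟩
    have h3 := norm_add_le (S i (x k) - x k) (x k)
    rw [sub_add_cancel] at h3
    have h4 := hbx k
    dsimp only at h2 ⊢
    linarith
  have hclim : ∀ i < m, Tendsto (fun k => max 0 (c (i + 1) (S i (x k)))) atTop (nhds 0) := by
    intro i hi
    obtain ⟨M, hM⟩ := (hb _ (hmem i hi) _ (hSb i hi.le)).exists_norm_le
    have h1 := (hdiff i hi).mul_const M
    rw [zero_mul] at h1
    refine squeeze_zero (fun k => le_max_left _ _) (fun k => ?_) h1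
    refine (hcut z hz (x k) i hi).2.trans ?_
    exact mul_le_mul_of_nonneg_left (hM _ ⟨_, ⟨k, rfl⟩, rfl⟩) (norm_nonneg _)
  obtain ⟨p, hp, hpw⟩ := opial_fejer x {z | ∀ i ∈ Finset.Icc 1 m, c i z ≤ 0} ⟨z, hz⟩
    hmono ⟨_, hbx⟩ (by
      intro F hF p hp j hj
      obtain ⟨i, rfl⟩ : ∃ i, j = i + 1 := ⟨j - 1, by rw [Finset.mem_Icc] at hj; omega⟩
      have hi : i < m := by rw [Finset.mem_Icc] at hj; omega
      have h1 : Tendsto (fun k => ⟪S i (x k) - x k, g (i + 1) p⟫) F (nhds 0) := by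
        have := ((hdiff0 i hi.le).mono_left hF).inner
          (tendsto_const_nhds (x := g (i + 1) p) (f := (F : Filter ℕ))) (𝕜 := ℝ)
        rwa [inner_zero_left] at this
      have h2 := (((hclim i hi).mono_left hF).sub h1).sub
        ((hp (g (i + 1) p)).sub_const ⟪p, g (i + 1) p⟫)
      simp only [sub_self, sub_zero] at h2
      refine ge_of_tendsto' h2 (fun k => ?_)
      have h3 := hg _ hj p (S i (x k))
      have h4 := le_max_right 0 (c (i + 1) (S i (x k)))
      rw [real_inner_comm, inner_sub_left] at h3
      rw [inner_sub_left]
      linarith)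
  exact ⟨p, hp, hpw⟩
end
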